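/- For every integer m ≥ 3, H(m,m) ≥ (m+2)·ln(m+2)/(3 ln 2) − ((m+2)/3)·(1 + ln 3/ln 2) + 1. -/

import Mathlib

open Filter Polynomial

/-- `Γ` is a periodic orbit of the planar vector field `V`: the image of a
nonconstant periodic solution of `γ' = V ∘ γ`. -/
def IsPeriodicOrbit (V : ℝ × ℝ → ℝ × ℝ) (Γ : Set (ℝ × ℝ)) : Prop :=
  ∃ γ : ℝ → ℝ × ℝ,
    (∀ t : ℝ, HasDerivAt γ (V (γ t)) t) ∧
    (∃ T : ℝ, 0 < T ∧ Function.Periodic γ T) ∧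
    (∃ t₁ t₂ : ℝ, γ t₁ ≠ γ t₂) ∧
    Γ = Set.range γ

/-- `Γ` is a limit cycle of `V`: a periodic orbit which is isolated among
periodic orbits. -/
def IsLimitCycle (V : ℝ × ℝ → ℝ × ℝ) (Γ : Set (ℝ × ℝ)) : Prop :=
  IsPeriodicOrbit V Γ ∧
  ∃ U : Set (ℝ × ℝ), IsOpen U ∧ Γ ⊆ U ∧
    ∀ Γ' : Set (ℝ × ℝ), IsPeriodicOrbit V Γ' → Γ' ⊆ U → Γ' = Γ

/-- The Liénard vector field `ẋ = y, ẏ = -g(x) - ε f(x) y`. -/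
def lienard (f g : Polynomial ℝ) (ε : ℝ) : ℝ × ℝ → ℝ × ℝ :=
  fun p => (p.2, -(g.eval p.1) - ε * (f.eval p.1) * p.2)

/-- `HGe n m c` formalizes `H(n,m) ≥ c`: there are polynomials `f, g` with
`deg f ≤ n`, `deg g ≤ m` and `ε₀ > 0` such that for every `0 < ε ≤ ε₀` the
Liénard system has at least `c` pairwise distinct limit cycles. -/
def HGe (n m : ℕ) (c : ℝ) : Prop :=
  ∃ f g : Polynomial ℝ, f.natDegree ≤ n ∧ g.natDegree ≤ m ∧
    ∃ ε₀ : ℝ, 0 < ε₀ ∧ ∀ ε : ℝ, 0 < ε → ε ≤ ε₀ →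
      ∃ S : Finset (Set (ℝ × ℝ)),
        (∀ Γ ∈ S, IsLimitCycle (lienard f g ε) Γ) ∧ c ≤ (S.card : ℝ)

section LimitCycles

open Set Topology Function

/-- A bounded function whose logarithmic derivative is, on average over a period, bounded below by
a positive constant vanishes identically. -/
lemma eq_zero_of_bounded_of_expanding {d d' q : ℝ → ℝ} {η K : ℝ} (hq : Continuous q)
    (hper : Function.Periodic q (2 * Real.pi))
    (hqint : 2 * Real.pi * η < ∫ θ in (0 : ℝ)..2 * Real.pi, q θ)
    (hd : ∀ θ, HasDerivAt d (d' θ) θ) (hlin : ∀ θ, |d' θ - q θ * d θ| ≤ η * |d θ|)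
    (hbd : ∀ θ, |d θ| ≤ K) (θ : ℝ) : d θ = 0 := by
  set c : ℝ := (∫ θ in (0 : ℝ)..2 * Real.pi, q θ) - 2 * Real.pi * η with hc
  have hcpos : 0 < c := by linarith
  set Q : ℝ → ℝ := fun θ => (∫ t in (0 : ℝ)..θ, q t) - η * θ with hQ
  have hQd : ∀ θ, HasDerivAt Q (q θ - η) θ := fun θ => by
    have h1 := (hq.integral_hasStrictDerivAt 0 θ).hasDerivAt
    exact (h1.sub ((hasDerivAt_id θ).const_mul η)).congr_deriv (by simp)
  have hQn : ∀ n : ℕ, Q (θ + n * (2 * Real.pi)) = Q θ + n * c := by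
    intro n
    induction n with
    | zero => simp
    | succ n ih =>
      have h1 := hper.intervalIntegral_add_eq_add 0 (θ + n * (2 * Real.pi))
        (fun a b => hq.intervalIntegrable a b)
      have h2 : θ + ((n + 1 : ℕ) : ℝ) * (2 * Real.pi)
          = θ + n * (2 * Real.pi) + 2 * Real.pi := by push_cast; ring
      simp only [hQ] at ih ⊢
      rw [h2, h1]
      simp only [zero_add]
      push_cast
      rw [hc]
      linarith
  set v : ℝ → ℝ := fun θ => d θ ^ 2 * Real.exp (-2 * Q θ) with hv
  have hvd : ∀ θ, HasDerivAt v
      (2 * (d θ * d' θ - (q θ - η) * d θ ^ 2) * Real.exp (-2 * Q θ)) θ := fun θ => by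
    have h1 := ((hd θ).pow 2).mul (((hQd θ).const_mul (-2)).exp)
    refine h1.congr_deriv ?_
    simp
    ring
  have hmono : Monotone v := by
    refine monotone_of_deriv_nonneg (fun θ => (hvd θ).differentiableAt) fun θ => ?_
    rw [(hvd θ).deriv]
    refine mul_nonneg (mul_nonneg zero_le_two ?_) (Real.exp_pos _).le
    have h1 : |d θ * (d' θ - q θ * d θ)| ≤ η * d θ ^ 2 := by
      rw [abs_mul]
      calc |d θ| * |d' θ - q θ * d θ| ≤ |d θ| * (η * |d θ|) :=
            mul_le_mul_of_nonneg_left (hlin θ) (abs_nonneg _)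
        _ = η * d θ ^ 2 := by rw [← sq_abs (d θ)]; ring
    nlinarith [(abs_le.1 h1).1]
  by_contra hne
  have hpos : 0 < d θ ^ 2 := by positivity
  have key : ∀ n : ℕ, d θ ^ 2 * Real.exp (2 * (n * c)) ≤ K ^ 2 := by
    intro n
    have h1 : v θ ≤ v (θ + n * (2 * Real.pi)) :=
      hmono (by have := Real.two_pi_pos; nlinarith [Nat.cast_nonneg (α := ℝ) n])
    simp only [hv, hQn] at h1
    have h2 : Real.exp (-2 * Q θ) = Real.exp (-2 * (Q θ + n * c)) * Real.exp (2 * (n * c)) := by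
      rw [← Real.exp_add]; ring_nf
    rw [h2] at h1
    have h3 : d θ ^ 2 * Real.exp (2 * (n * c)) ≤ d (θ + n * (2 * Real.pi)) ^ 2 := by
      have := Real.exp_pos (-2 * (Q θ + n * c))
      refine le_of_mul_le_mul_right ?_ this
      linarith
    refine h3.trans (sq_le_sq' ?_ ?_) <;> linarith [abs_le.1 (hbd (θ + n * (2 * Real.pi)))]
  obtain ⟨n, hn⟩ := exists_nat_gt (K ^ 2 / (d θ ^ 2 * (2 * c)))
  have h1 := key n
  have h2 := Real.add_one_le_exp (2 * (n * c))
  rw [div_lt_iff₀ (by positivity)] at hn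
  nlinarith

/-- A solution of a `2π`-periodic scalar equation on `[0, 2π]` with equal end values extends to a
periodic solution on the line. -/
lemma exists_periodic_extension {φ : ℝ → ℝ → ℝ} {ρ : ℝ → ℝ}
    (hper : ∀ θ r, φ (θ + 2 * Real.pi) r = φ θ r)
    (hρ : ∀ t ∈ Icc 0 (2 * Real.pi),
      HasDerivWithinAt ρ (φ t (ρ t)) (Icc 0 (2 * Real.pi)) t)
    (hend : ρ (2 * Real.pi) = ρ 0)
    (hψ : ContinuousOn (fun t => φ t (ρ t)) (Icc 0 (2 * Real.pi))) :
    ∃ r : ℝ → ℝ, Function.Periodic r (2 * Real.pi) ∧ EqOn r ρ (Icc 0 (2 * Real.pi)) ∧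
      ∀ θ, HasDerivAt r (φ θ (r θ)) θ := by
  have hpi := Real.two_pi_pos
  have : Fact (0 < 2 * Real.pi) := ⟨hpi⟩
  set ψ : ℝ → ℝ :=
    fun t => AddCircle.liftIco (2 * Real.pi) 0 (fun t => φ t (ρ t)) (t : AddCircle (2 * Real.pi))
    with hψdef
  have hclosed : φ (2 * Real.pi) (ρ (2 * Real.pi)) = φ 0 (ρ 0) := by
    have := hper 0 (ρ 0)
    rw [zero_add] at this
    rw [hend, this]
  have hψc : Continuous ψ := by
    have h1 : Continuous (AddCircle.liftIco (2 * Real.pi) 0 (fun t => φ t (ρ t))) := by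
      refine AddCircle.liftIco_continuous ?_ ?_
      · simpa using hclosed.symm
      · simpa using hψ
    exact h1.comp continuous_quotient_mk'

  have hψp : Function.Periodic ψ (2 * Real.pi) := fun t => by simp [hψdef]
  have hψeq : ∀ t ∈ Icc 0 (2 * Real.pi), ψ t = φ t (ρ t) := by
    intro t ht
    rcases ht.2.eq_or_lt with h | h
    · have h0 : ψ (2 * Real.pi) = ψ 0 := by simpa using hψp 0
      rw [h, h0, hclosed]
      exact AddCircle.liftIco_coe_apply (by simp [hpi])
    · exact AddCircle.liftIco_coe_apply (by simpa using ⟨ht.1, h⟩)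
  set R : ℝ → ℝ := fun θ => ρ 0 + ∫ t in (0 : ℝ)..θ, ψ t with hR
  have hRd : ∀ θ, HasDerivAt R (ψ θ) θ := fun θ =>
    (hψc.integral_hasStrictDerivAt 0 θ).hasDerivAt.const_add _
  have hReq : ∀ t ∈ Icc 0 (2 * Real.pi), R t = ρ t := by
    intro t ht
    have hsub : Icc 0 t ⊆ Icc 0 (2 * Real.pi) := Icc_subset_Icc_right ht.2
    have := intervalIntegral.integral_eq_sub_of_hasDerivAt_of_le (f := ρ) (f' := ψ) ht.1
      (fun x hx => ((hρ x (hsub hx)).mono hsub).continuousWithinAt)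
      (fun x hx => by
        have hx' := hsub (Ioo_subset_Icc_self hx)
        rw [hψeq x hx']
        exact (hρ x hx').hasDerivAt (Icc_mem_nhds hx.1 (hx.2.trans_le ht.2)))
      (hψc.intervalIntegrable 0 t)
    simp only [hR]
    linarith
  have hRp : Function.Periodic R (2 * Real.pi) := fun θ => by
    have h1 := hψp.intervalIntegral_add_eq_add 0 θ (fun a b => hψc.intervalIntegrable a b)
    have h2 := hReq (2 * Real.pi) ⟨hpi.le, le_rfl⟩
    simp only [hR, hend] at h2
    simp only [hR, h1, zero_add]
    linarith
  refine ⟨R, hRp, fun t ht => hReq t ht, fun θ => ?_⟩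
  have hdp : Function.Periodic (fun θ => ψ θ - φ θ (R θ)) (2 * Real.pi) := fun θ => by
    simp only [hψp θ, hRp θ, hper]
  obtain ⟨t, ht, hθt⟩ := hdp.exists_mem_Ico₀ hpi θ
  have ht' := Ico_subset_Icc_self ht
  have : ψ θ - φ θ (R θ) = 0 := by rw [hθt, hψeq t ht', hReq t ht', sub_self]
  rw [← sub_eq_zero.1 this]
  exact hRd θ

/-- Existence of a periodic solution of a scalar periodic equation from opposite average drifts near
two levels `a ≤ b`. -/
lemma exists_periodic_solution {φ : ℝ → ℝ → ℝ} {a b d C : ℝ} {K : NNReal} (hab : a ≤ b)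
    (hd : 0 ≤ d) (hper : ∀ θ r, φ (θ + 2 * Real.pi) r = φ θ r)
    (hcont : ∀ r ∈ Icc (a - d) (b + d), ContinuousOn (φ · r) (Icc 0 (2 * Real.pi)))
    (hlip : ∀ θ ∈ Icc 0 (2 * Real.pi), LipschitzOnWith K (φ θ) (Icc (a - d) (b + d)))
    (hC : ∀ θ ∈ Icc 0 (2 * Real.pi), ∀ r ∈ Icc (a - d) (b + d), |φ θ r| ≤ C)
    (hCd : C * (2 * Real.pi) ≤ d)
    (hpos : ∀ r : ℝ → ℝ, ContinuousOn (fun θ => φ θ (r θ)) (Icc 0 (2 * Real.pi)) →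
      (∀ θ ∈ Icc 0 (2 * Real.pi), |r θ - b| ≤ d) →
      0 ≤ ∫ θ in (0 : ℝ)..2 * Real.pi, φ θ (r θ))
    (hneg : ∀ r : ℝ → ℝ, ContinuousOn (fun θ => φ θ (r θ)) (Icc 0 (2 * Real.pi)) →
      (∀ θ ∈ Icc 0 (2 * Real.pi), |r θ - a| ≤ d) →
      ∫ θ in (0 : ℝ)..2 * Real.pi, φ θ (r θ) ≤ 0) :
    ∃ r : ℝ → ℝ, Function.Periodic r (2 * Real.pi) ∧ (∀ θ, r θ ∈ Icc (a - d) (b + d)) ∧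
      ∀ θ, HasDerivAt r (φ θ (r θ)) θ := by
  have hpi := Real.two_pi_pos
  have h0mem : (0 : ℝ) ∈ Icc 0 (2 * Real.pi) := ⟨le_rfl, hpi.le⟩
  have hC0 : 0 ≤ C := (abs_nonneg _).trans (hC 0 h0mem a ⟨by linarith, by linarith⟩)
  have hle : a - d ≤ b + d := by linarith
  set φ' : ℝ → ℝ → ℝ := fun θ x => φ θ (projIcc (a - d) (b + d) hle x) with hφ'
  have hφ'eq : ∀ θ, ∀ x ∈ Icc (a - d) (b + d), φ' θ x = φ θ x := fun θ x hx => by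
    simp only [hφ', projIcc_of_mem hle hx]
  obtain ⟨R₁, hR₁⟩ : ∃ R₁ : NNReal, (R₁ : ℝ) = (b - a) / 2 + d := ⟨⟨_, by linarith⟩, rfl⟩
  obtain ⟨R₂, hR₂⟩ : ∃ R₂ : NNReal, (R₂ : ℝ) = (b - a) / 2 := ⟨⟨_, by linarith⟩, rfl⟩
  obtain ⟨C', hC'⟩ : ∃ C' : NNReal, (C' : ℝ) = C := ⟨⟨_, hC0⟩, rfl⟩
  have hball : Metric.closedBall ((a + b) / 2) R₁ = Icc (a - d) (b + d) := by
    rw [Real.closedBall_eq_Icc, hR₁]; congr 1 <;> ring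
  have hball' : Metric.closedBall ((a + b) / 2) R₂ = Icc a b := by
    rw [Real.closedBall_eq_Icc, hR₂]; congr 1 <;> ring
  have hPL : IsPicardLindelof φ' (tmin := 0) (tmax := 2 * Real.pi) ⟨0, h0mem⟩ ((a + b) / 2)
      R₁ R₂ C' K := by
    refine ⟨fun t ht => ?_, fun x hx => ?_, fun t ht x hx => ?_, ?_⟩
    · rw [hball]
      intro x hx y hy
      rw [hφ'eq t x hx, hφ'eq t y hy]
      exact hlip t ht hx hy
    · exact hcont _ (projIcc (a - d) (b + d) hle x).2
    · rw [hC']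
      exact hC t ht _ (projIcc (a - d) (b + d) hle x).2
    · simp only [sub_zero, sub_self, max_eq_left hpi.le, hR₁, hR₂, hC']
      linarith
  obtain ⟨α, hα, L', hL'⟩ :=
    hPL.exists_forall_mem_closedBall_eq_hasDerivWithinAt_lipschitzOnWith
  rw [hball'] at hα hL'
  have hmem : ∀ x ∈ Icc a b, ∀ t ∈ Icc 0 (2 * Real.pi), |α x t - x| ≤ d := by
    intro x hx t ht
    have h1 := norm_image_sub_le_of_norm_deriv_le_segment' (hα x hx).2
      (fun t ht => hC t (Ico_subset_Icc_self ht) _ (projIcc (a - d) (b + d) hle (α x t)).2) t ht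
    simp only [(hα x hx).1, sub_zero, Real.norm_eq_abs] at h1
    exact h1.trans ((mul_le_mul_of_nonneg_left ht.2 hC0).trans hCd)
  have hband : ∀ x ∈ Icc a b, ∀ t ∈ Icc 0 (2 * Real.pi), α x t ∈ Icc (a - d) (b + d) := by
    intro x hx t ht
    have := abs_le.1 (hmem x hx t ht)
    exact ⟨by linarith [hx.1], by linarith [hx.2]⟩
  have hsol : ∀ x ∈ Icc a b, ∀ t ∈ Icc 0 (2 * Real.pi),
      HasDerivWithinAt (α x) (φ t (α x t)) (Icc 0 (2 * Real.pi)) t := fun x hx t ht => by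
    rw [← hφ'eq t _ (hband x hx t ht)]
    exact (hα x hx).2 t ht
  have hjc : ContinuousOn (uncurry φ) (Icc 0 (2 * Real.pi) ×ˢ Icc (a - d) (b + d)) :=
    continuousOn_prod_of_continuousOn_lipschitzOnWith' _ K hlip hcont
  have hψc : ∀ x ∈ Icc a b, ContinuousOn (fun t => φ t (α x t)) (Icc 0 (2 * Real.pi)) :=
    fun x hx => hjc.comp (f := fun t => (t, α x t))
      (continuousOn_id.prodMk fun t ht => (hsol x hx t ht).continuousWithinAt)
      fun t ht => ⟨ht, hband x hx t ht⟩
  have hqint : ∀ x ∈ Icc a b,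
      ∫ θ in (0 : ℝ)..2 * Real.pi, φ θ (α x θ) = α x (2 * Real.pi) - x := by
    intro x hx
    have h1 := intervalIntegral.integral_eq_sub_of_hasDerivAt_of_le hpi.le
      (fun t ht => (hsol x hx t ht).continuousWithinAt)
      (fun t ht => (hsol x hx t (Ioo_subset_Icc_self ht)).hasDerivAt (Icc_mem_nhds ht.1 ht.2))
      ((hψc x hx).intervalIntegrable_of_Icc hpi.le)
    rw [h1, (hα x hx).1]
  have hPc : ContinuousOn (fun x => α x (2 * Real.pi) - x) (Icc a b) :=
    (hL' _ ⟨hpi.le, le_rfl⟩).continuousOn.sub continuousOn_id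
  obtain ⟨x, hx, hx0⟩ : (0 : ℝ) ∈ (fun x => α x (2 * Real.pi) - x) '' Icc a b := by
    refine intermediate_value_Icc hab hPc ⟨?_, ?_⟩
    · have ha : a ∈ Icc a b := ⟨le_rfl, hab⟩
      rw [← hqint a ha]
      exact hneg _ (hψc a ha) (hmem a ha)
    · have hb : b ∈ Icc a b := ⟨hab, le_rfl⟩
      rw [← hqint b hb]
      exact hpos _ (hψc b hb) (hmem b hb)
  obtain ⟨r, hr, hreq, hrd⟩ := exists_periodic_extension hper (hsol x hx)
    (by rw [(hα x hx).1]; exact sub_eq_zero.1 hx0) (hψc x hx)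
  refine ⟨r, hr, fun θ => ?_, hrd⟩
  obtain ⟨t, ht, hθt⟩ := hr.exists_mem_Ico₀ hpi θ
  rw [hθt, hreq (Ico_subset_Icc_self ht)]
  exact hband x hx t (Ico_subset_Icc_self ht)

/-- Existence and uniqueness of a periodic solution of `r' = ε φ(θ, r)` near `r₀` when `φ` is close
to an affine function of `r` whose mean value has a simple zero with positive slope at `r₀`. -/
lemma exists_unique_periodic_of_approx {φ : ℝ → ℝ → ℝ} {p q : ℝ → ℝ} {r₀ κ D P Q : ℝ}
    (hκ : 0 < κ) (hD : 0 < D) (hP : ∀ θ, |p θ| ≤ P) (hQ : ∀ θ, |q θ| ≤ Q)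
    (hp : Continuous p) (hq : Continuous q) (hqper : Function.Periodic q (2 * Real.pi))
    (hp0 : ∫ θ in (0 : ℝ)..2 * Real.pi, p θ = 0)
    (hqD : ∫ θ in (0 : ℝ)..2 * Real.pi, q θ = D)
    (hper : ∀ θ r, φ (θ + 2 * Real.pi) r = φ θ r)
    (hcont : ∀ r ∈ Icc (r₀ - κ) (r₀ + κ), Continuous (φ · r))
    (hlip : ∀ θ, ∀ u ∈ Icc (r₀ - κ) (r₀ + κ), ∀ v ∈ Icc (r₀ - κ) (r₀ + κ),
      |φ θ u - φ θ v - q θ * (u - v)| ≤ D / (8 * Real.pi) * |u - v|)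
    (happ : ∀ θ, |φ θ r₀ - p θ| ≤ D * κ / (32 * Real.pi)) {ε : ℝ} (hε : 0 < ε)
    (hεs : ε * (P + D * κ / (32 * Real.pi) + (Q + D / (8 * Real.pi)) * κ) * (2 * Real.pi) ≤
      min (κ / 8) (D * κ / (32 * Real.pi * (Q + 1)))) :
    (∃ r : ℝ → ℝ, Function.Periodic r (2 * Real.pi) ∧
      (∀ θ, r θ ∈ Ioo (r₀ - κ) (r₀ + κ)) ∧ ∀ θ, HasDerivAt r (ε * φ θ (r θ)) θ) ∧
    ∀ u v : ℝ → ℝ, (∀ θ, u θ ∈ Icc (r₀ - κ) (r₀ + κ)) → (∀ θ, v θ ∈ Icc (r₀ - κ) (r₀ + κ)) →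
      (∀ θ, HasDerivAt u (ε * φ θ (u θ)) θ) → (∀ θ, HasDerivAt v (ε * φ θ (v θ)) θ) → u = v := by
  have hpi := Real.pi_pos
  have hQ0 : 0 ≤ Q := (abs_nonneg _).trans (hQ 0)
  have hP0 : 0 ≤ P := (abs_nonneg _).trans (hP 0)
  refine ⟨?_, fun u v hu hv hu' hv' => ?_⟩
  · set d := min (κ / 8) (D * κ / (32 * Real.pi * (Q + 1))) with hd
    have hd0 : 0 < d := lt_min (by positivity) (by positivity)
    have hd1 : d ≤ κ / 8 := min_le_left _ _
    have hd2 : Q * d ≤ D * κ / (32 * Real.pi) := by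
      have h1 : d ≤ D * κ / (32 * Real.pi * (Q + 1)) := min_le_right _ _
      rw [le_div_iff₀ (by positivity)] at h1 ⊢
      have : 0 ≤ 32 * Real.pi * d := by positivity
      nlinarith
    have hsub : Icc (r₀ - κ / 2 - d) (r₀ + κ / 2 + d) ⊆ Icc (r₀ - κ) (r₀ + κ) :=
      Icc_subset_Icc (by linarith) (by linarith)
    have hr₀ : r₀ ∈ Icc (r₀ - κ) (r₀ + κ) := ⟨by linarith, by linarith⟩
    set c : ℝ := D * κ / (32 * Real.pi) + D * κ / (32 * Real.pi) +
      D / (8 * Real.pi) * (κ / 2 + d) with hc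
    have hcD : 2 * Real.pi * c ≤ D * (κ / 2) := by
      have : 2 * Real.pi * c = D * κ / 8 + D * (κ / 2 + d) / 4 := by
        rw [hc]; field_simp; ring
      rw [this]; nlinarith
    have key : ∀ σ : ℝ, |σ| = 1 → ∀ x, |x - (r₀ + σ * (κ / 2))| ≤ d → ∀ θ,
        |φ θ x - (p θ + q θ * (σ * (κ / 2)))| ≤ c := by
      intro σ hσ x hx θ
      have hx1 : |x - r₀| ≤ κ / 2 + d := by
        have h1 : |σ * (κ / 2)| = κ / 2 := by rw [abs_mul, hσ, one_mul, abs_of_pos (by positivity)]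
        calc |x - r₀| = |(x - (r₀ + σ * (κ / 2))) + σ * (κ / 2)| := by ring_nf
          _ ≤ _ := abs_add_le _ _
          _ ≤ _ := by linarith
      have hxm : x ∈ Icc (r₀ - κ) (r₀ + κ) := by
        rw [abs_le] at hx1; exact ⟨by linarith, by linarith⟩
      have h1 := hlip θ x hxm r₀ hr₀
      have h2 := happ θ
      have h3 : |q θ * (x - (r₀ + σ * (κ / 2)))| ≤ D * κ / (32 * Real.pi) := by
        rw [abs_mul]
        exact (mul_le_mul (hQ θ) hx (abs_nonneg _) hQ0).trans hd2
      have h4 : D / (8 * Real.pi) * |x - r₀| ≤ D / (8 * Real.pi) * (κ / 2 + d) := by gcongr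
      calc |φ θ x - (p θ + q θ * (σ * (κ / 2)))| = |(φ θ x - φ θ r₀ - q θ * (x - r₀)) +
            (φ θ r₀ - p θ) + q θ * (x - (r₀ + σ * (κ / 2)))| := by ring_nf
        _ ≤ _ := abs_add_three _ _ _
        _ ≤ c := by rw [hc]; linarith
    have hqint : ∀ σ : ℝ, ∀ e : ℝ, ∫ θ in (0 : ℝ)..2 * Real.pi,
        ε * (p θ + q θ * (σ * (κ / 2)) + e) =
        ε * (D * (σ * (κ / 2)) + 2 * Real.pi * e) := by
      intro σ e
      rw [intervalIntegral.integral_const_mul, intervalIntegral.integral_add,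
        intervalIntegral.integral_add, intervalIntegral.integral_mul_const, hp0, hqD]
      · simp
      all_goals exact Continuous.intervalIntegrable (by fun_prop) _ _
    obtain ⟨K, hK⟩ : ∃ K : NNReal, (K : ℝ) = ε * (Q + D / (8 * Real.pi)) :=
      ⟨⟨_, by positivity⟩, rfl⟩
    have hlip' : ∀ θ, ∀ u ∈ Icc (r₀ - κ) (r₀ + κ), ∀ v ∈ Icc (r₀ - κ) (r₀ + κ),
        |φ θ u - φ θ v| ≤ (Q + D / (8 * Real.pi)) * |u - v| := by
      intro θ u hu v hv
      have h1 := hlip θ u hu v hv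
      have h2 : |q θ * (u - v)| ≤ Q * |u - v| := by
        rw [abs_mul]; exact mul_le_mul_of_nonneg_right (hQ θ) (abs_nonneg _)
      calc |φ θ u - φ θ v| = |(φ θ u - φ θ v - q θ * (u - v)) + q θ * (u - v)| := by ring_nf
        _ ≤ _ := abs_add_le _ _
        _ ≤ _ := by linarith
    obtain ⟨r, h1, h2, h3⟩ := exists_periodic_solution (φ := fun θ r => ε * φ θ r)
      (a := r₀ - κ / 2) (b := r₀ + κ / 2) (d := d) (K := K)
      (C := ε * (P + D * κ / (32 * Real.pi) + (Q + D / (8 * Real.pi)) * κ)) (by linarith) hd0.le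
      (fun θ r => by simp only [hper])
      (fun r hr => ((hcont r (hsub hr)).const_mul ε).continuousOn)
      (fun θ _ => LipschitzOnWith.of_dist_le_mul fun u hu v hv => by
        rw [Real.dist_eq, Real.dist_eq, hK, ← mul_sub, abs_mul, abs_of_pos hε, mul_assoc]
        exact mul_le_mul_of_nonneg_left (hlip' θ u (hsub hu) v (hsub hv)) hε.le)
      (fun θ _ x hx => by
        have hx' := hsub hx
        have hxk : |x - r₀| ≤ κ := by rw [abs_le]; exact ⟨by linarith [hx'.1], by linarith [hx'.2]⟩
        rw [abs_mul, abs_of_pos hε]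
        refine mul_le_mul_of_nonneg_left ?_ hε.le
        have e1 := hlip' θ x hx' r₀ hr₀
        have e2 : (Q + D / (8 * Real.pi)) * |x - r₀| ≤ (Q + D / (8 * Real.pi)) * κ := by gcongr
        calc |φ θ x| = |p θ + (φ θ r₀ - p θ) + (φ θ x - φ θ r₀)| := by ring_nf
          _ ≤ _ := abs_add_three _ _ _
          _ ≤ _ := by linarith [hP θ, happ θ]) hεs
      (fun r hr hrb => by
        have := intervalIntegral.integral_mono_on (μ := MeasureTheory.volume) (a := 0)
          (b := 2 * Real.pi)
          (f := fun θ => ε * (p θ + q θ * (1 * (κ / 2)) + -c)) (g := fun θ => ε * φ θ (r θ))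
          (by positivity) (Continuous.intervalIntegrable (by fun_prop) _ _)
          (ContinuousOn.intervalIntegrable (by rwa [uIcc_of_le (by positivity)]))
          (fun θ hθ => mul_le_mul_of_nonneg_left (by
            have := (abs_le.1 (key 1 (by simp) (r θ) (by simpa using hrb θ hθ) θ)).1
            linarith) hε.le)
        rw [hqint] at this
        refine le_trans (mul_nonneg hε.le ?_) this
        linarith)
      (fun r hr hrb => by
        have := intervalIntegral.integral_mono_on (μ := MeasureTheory.volume) (a := 0)
          (b := 2 * Real.pi)
          (g := fun θ => ε * (p θ + q θ * (-1 * (κ / 2)) + c)) (f := fun θ => ε * φ θ (r θ))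
          (by positivity)
          (ContinuousOn.intervalIntegrable (by rwa [uIcc_of_le (by positivity)]))
          (Continuous.intervalIntegrable (by fun_prop) _ _)
          (fun θ hθ => mul_le_mul_of_nonneg_left (by
            have := (abs_le.1 (key (-1) (by simp) (r θ)
              (by have := hrb θ hθ; rwa [show r₀ + -1 * (κ / 2) = r₀ - κ / 2 by ring]) θ)).2
            linarith) hε.le)
        rw [hqint] at this
        refine le_trans this (mul_nonpos_of_nonneg_of_nonpos hε.le ?_)
        linarith)
    exact ⟨r, h1, fun θ => ⟨by linarith [(h2 θ).1], by linarith [(h2 θ).2]⟩, h3⟩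
  · funext θ
    refine sub_eq_zero.1 (eq_zero_of_bounded_of_expanding (d := fun θ => u θ - v θ)
      (q := fun θ => ε * q θ) (η := ε * (D / (8 * Real.pi))) (K := 2 * κ) (by fun_prop)
      (fun θ => by simp only [hqper θ]) ?_ (fun θ => (hu' θ).sub (hv' θ)) (fun θ => ?_)
      (fun θ => ?_) θ)
    · rw [intervalIntegral.integral_const_mul, hqD]
      have : 2 * Real.pi * (ε * (D / (8 * Real.pi))) = ε * D / 4 := by field_simp; ring
      rw [this]; nlinarith [mul_pos hε hD]
    · have := mul_le_mul_of_nonneg_left (hlip θ _ (hu θ) _ (hv θ)) hε.le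
      rw [← abs_of_pos hε, ← abs_mul, abs_of_pos hε] at this
      calc _ = |ε * (φ θ (u θ) - φ θ (v θ) - q θ * (u θ - v θ))| := by ring_nf
        _ ≤ _ := this
        _ = _ := by ring
    · rw [abs_le]; constructor <;> linarith [(hu θ).1, (hu θ).2, (hv θ).1, (hv θ).2]

lemma Function.Periodic.forall_of_forall_mem_Icc {P : ℝ → Prop} {c : ℝ} (hc : 0 < c)
    (hP : Function.Periodic P c) (h : ∀ θ ∈ Icc 0 c, P θ) (θ : ℝ) : P θ := by
  obtain ⟨y, hy, hxy⟩ := hP.exists_mem_Ico₀ hc θ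
  exact hxy ▸ h y (Ico_subset_Icc_self hy)

lemma exists_unique_periodic_of_averaging_of_pos {Φ Ψ : ℝ → ℝ → ℝ → ℝ} {ε₁ κ₀ κ₁ r₀ : ℝ}
    (hε₁ : 0 < ε₁) (hκ₀ : 0 < κ₀) (hκ₁ : 0 < κ₁)
    (hΦ : ContinuousOn (fun z : ℝ × ℝ × ℝ => Φ z.1 z.2.1 z.2.2)
      (Ioo (-ε₁) ε₁ ×ˢ univ ×ˢ Ioo (r₀ - κ₀) (r₀ + κ₀)))
    (hΨ : ContinuousOn (fun z : ℝ × ℝ × ℝ => Ψ z.1 z.2.1 z.2.2)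
      (Ioo (-ε₁) ε₁ ×ˢ univ ×ˢ Ioo (r₀ - κ₀) (r₀ + κ₀)))
    (hder : ∀ ε ∈ Ioo (-ε₁) ε₁, ∀ θ, ∀ r ∈ Ioo (r₀ - κ₀) (r₀ + κ₀),
      HasDerivAt (Φ ε θ) (Ψ ε θ r) r)
    (hperΦ : ∀ ε θ r, Φ ε (θ + 2 * Real.pi) r = Φ ε θ r)
    (hperΨ : ∀ ε θ r, Ψ ε (θ + 2 * Real.pi) r = Ψ ε θ r)
    (h0 : ∫ θ in (0 : ℝ)..2 * Real.pi, Φ 0 θ r₀ = 0)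
    (hD : 0 < ∫ θ in (0 : ℝ)..2 * Real.pi, Ψ 0 θ r₀) :
    ∃ κ, 0 < κ ∧ κ < κ₁ ∧ κ < κ₀ ∧ ∃ ε₀ > 0, ∀ ε, 0 < ε → ε ≤ ε₀ →
      (∃ r : ℝ → ℝ, Function.Periodic r (2 * Real.pi) ∧
        (∀ θ, r θ ∈ Ioo (r₀ - κ) (r₀ + κ)) ∧ ∀ θ, HasDerivAt r (ε * Φ ε θ (r θ)) θ) ∧
      ∀ u v : ℝ → ℝ, (∀ θ, u θ ∈ Icc (r₀ - κ) (r₀ + κ)) → (∀ θ, v θ ∈ Icc (r₀ - κ) (r₀ + κ)) →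
        (∀ θ, HasDerivAt u (ε * Φ ε θ (u θ)) θ) → (∀ θ, HasDerivAt v (ε * Φ ε θ (v θ)) θ) →
        u = v := by
  have hpi := Real.two_pi_pos
  have hpi' := Real.pi_pos
  set D := ∫ θ in (0 : ℝ)..2 * Real.pi, Ψ 0 θ r₀ with hDdef
  have hop : IsOpen (Ioo (-ε₁) ε₁ ×ˢ (univ : Set ℝ) ×ˢ Ioo (r₀ - κ₀) (r₀ + κ₀)) :=
    isOpen_Ioo.prod (isOpen_univ.prod isOpen_Ioo)
  have hmem : ∀ {ε θ r}, ε ∈ Ioo (-ε₁) ε₁ → r ∈ Ioo (r₀ - κ₀) (r₀ + κ₀) →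
      (ε, θ, r) ∈ Ioo (-ε₁) ε₁ ×ˢ (univ : Set ℝ) ×ˢ Ioo (r₀ - κ₀) (r₀ + κ₀) :=
    fun h1 h2 => ⟨h1, mem_univ _, h2⟩
  have h0ε : (0 : ℝ) ∈ Ioo (-ε₁) ε₁ := ⟨by linarith, hε₁⟩
  have hr₀ : r₀ ∈ Ioo (r₀ - κ₀) (r₀ + κ₀) := ⟨by linarith, by linarith⟩
  have cΦ : ∀ {ε r}, ε ∈ Ioo (-ε₁) ε₁ → r ∈ Ioo (r₀ - κ₀) (r₀ + κ₀) →
      Continuous fun θ => Φ ε θ r := fun h1 h2 =>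
    hΦ.comp_continuous (f := fun θ => (_, θ, _)) (by fun_prop) fun _ => hmem h1 h2
  have cΨ : ∀ {ε r}, ε ∈ Ioo (-ε₁) ε₁ → r ∈ Ioo (r₀ - κ₀) (r₀ + κ₀) →
      Continuous fun θ => Ψ ε θ r := fun h1 h2 =>
    hΨ.comp_continuous (f := fun θ => (_, θ, _)) (by fun_prop) fun _ => hmem h1 h2
  obtain ⟨P, hP⟩ : ∃ P, ∀ θ, |Φ 0 θ r₀| ≤ P := by
    obtain ⟨P, hP⟩ := isCompact_Icc.exists_bound_of_continuousOn
      (s := Icc (0 : ℝ) (2 * Real.pi)) (cΦ h0ε hr₀).continuousOn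
    exact ⟨P, Function.Periodic.forall_of_forall_mem_Icc hpi
      (fun θ => by simp only [hperΦ]) hP⟩
  obtain ⟨Q, hQ⟩ : ∃ P, ∀ θ, |Ψ 0 θ r₀| ≤ P := by
    obtain ⟨P, hP⟩ := isCompact_Icc.exists_bound_of_continuousOn
      (s := Icc (0 : ℝ) (2 * Real.pi)) (cΨ h0ε hr₀).continuousOn
    exact ⟨P, Function.Periodic.forall_of_forall_mem_Icc hpi
      (fun θ => by simp only [hperΨ]) hP⟩
  have hP0 : 0 ≤ P := (abs_nonneg _).trans (hP 0)
  have hQ0 : 0 ≤ Q := (abs_nonneg _).trans (hQ 0)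
  have tΨ : ∀ᶠ x in 𝓝 ((0 : ℝ), r₀), ∀ θ ∈ Icc (0 : ℝ) (2 * Real.pi),
      |Ψ x.1 θ x.2 - Ψ 0 θ r₀| < D / (8 * Real.pi) := by
    refine isCompact_Icc.eventually_forall_of_forall_eventually
      (P := fun (x : ℝ × ℝ) (θ : ℝ) => |Ψ x.1 θ x.2 - Ψ 0 θ r₀| < D / (8 * Real.pi)) ?_
    intro θ _
    have h1 : ContinuousAt (fun z : (ℝ × ℝ) × ℝ => |Ψ z.1.1 z.2 z.1.2 - Ψ 0 z.2 r₀|)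
        ((0, r₀), θ) := by
      refine ContinuousAt.abs (ContinuousAt.sub ?_ ?_)
      · exact ContinuousAt.comp (f := fun z : (ℝ × ℝ) × ℝ => (z.1.1, z.2, z.1.2))
          (x := ((0, r₀), θ)) (hΨ.continuousAt (hop.mem_nhds (hmem h0ε hr₀))) (by fun_prop)
      · exact ((cΨ h0ε hr₀).comp continuous_snd).continuousAt
    refine h1.eventually_lt continuousAt_const ?_
    simp only [sub_self, abs_zero]; positivity
  obtain ⟨δ, hδ, hball⟩ := Metric.eventually_nhds_iff.1 tΨ
  set κ := min (δ / 2) (min (κ₀ / 2) (κ₁ / 2)) with hκ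
  have hκpos : 0 < κ := by positivity
  have hκδ : κ ≤ δ / 2 := min_le_left _ _
  have hκκ₀ : κ ≤ κ₀ / 2 := (min_le_right _ _).trans (min_le_left _ _)
  have hκκ₁ : κ ≤ κ₁ / 2 := (min_le_right _ _).trans (min_le_right _ _)
  have hsub : Icc (r₀ - κ) (r₀ + κ) ⊆ Ioo (r₀ - κ₀) (r₀ + κ₀) :=
    fun x hx => ⟨by linarith [hx.1], by linarith [hx.2]⟩
  have tΦ : ∀ᶠ ε in 𝓝 (0 : ℝ), ∀ θ ∈ Icc (0 : ℝ) (2 * Real.pi),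
      |Φ ε θ r₀ - Φ 0 θ r₀| < D * κ / (32 * Real.pi) := by
    refine isCompact_Icc.eventually_forall_of_forall_eventually
      (P := fun (x : ℝ) (θ : ℝ) => |Φ x θ r₀ - Φ 0 θ r₀| < D * κ / (32 * Real.pi)) ?_
    intro θ _
    have h1 : ContinuousAt (fun z : ℝ × ℝ => |Φ z.1 z.2 r₀ - Φ 0 z.2 r₀|) (0, θ) := by
      refine ContinuousAt.abs (ContinuousAt.sub ?_ ?_)
      · exact ContinuousAt.comp (f := fun z : ℝ × ℝ => (z.1, z.2, r₀))
          (x := (0, θ)) (hΦ.continuousAt (hop.mem_nhds (hmem h0ε hr₀))) (by fun_prop)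
      · exact ((cΦ h0ε hr₀).comp continuous_snd).continuousAt
    refine h1.eventually_lt continuousAt_const ?_
    simp only [sub_self, abs_zero]; positivity
  have tε : ∀ᶠ ε in 𝓝 (0 : ℝ),
      ε * (P + D * κ / (32 * Real.pi) + (Q + D / (8 * Real.pi)) * κ) * (2 * Real.pi) <
      min (κ / 8) (D * κ / (32 * Real.pi * (Q + 1))) := by
    refine ContinuousAt.eventually_lt (by fun_prop) continuousAt_const ?_
    simp only [zero_mul]; positivity
  obtain ⟨δ', hδ', hε⟩ := Metric.eventually_nhds_iff.1 (tΦ.and tε)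
  refine ⟨κ, hκpos, by linarith, by linarith, min (δ / 2) (min (δ' / 2) (ε₁ / 2)), by positivity,
    fun ε he hle => ?_⟩
  have hle1 : ε ≤ δ / 2 := hle.trans (min_le_left _ _)
  have hle2 : ε ≤ δ' / 2 := hle.trans ((min_le_right _ _).trans (min_le_left _ _))
  have hle3 : ε ≤ ε₁ / 2 := hle.trans ((min_le_right _ _).trans (min_le_right _ _))
  have hεmem : ε ∈ Ioo (-ε₁) ε₁ := ⟨by linarith, by linarith⟩
  obtain ⟨hε1, hε2⟩ := hε (y := ε) (by rw [Real.dist_eq, sub_zero, abs_of_pos he]; linarith)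
  refine exists_unique_periodic_of_approx (P := P) (Q := Q) hκpos hD hP hQ (cΦ h0ε hr₀)
    (cΨ h0ε hr₀) (fun θ => hperΨ _ _ _) h0 rfl (hperΦ ε) (fun r hr => cΦ hεmem (hsub hr))
    (Function.Periodic.forall_of_forall_mem_Icc hpi (fun θ => by simp only [hperΦ, hperΨ]) ?_)
    (Function.Periodic.forall_of_forall_mem_Icc hpi (fun θ => by simp only [hperΦ])
      fun θ hθ => (hε1 θ hθ).le) he hε2.le
  intro θ hθ u hu v hv
  have := (convex_Icc (r₀ - κ) (r₀ + κ)).norm_image_sub_le_of_norm_hasDerivWithin_le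
    (f := fun r => Φ ε θ r - Ψ 0 θ r₀ * r) (f' := fun r => Ψ ε θ r - Ψ 0 θ r₀)
    (C := D / (8 * Real.pi)) (x := v) (y := u)
    (fun r hr => (((hder ε hεmem θ r (hsub hr)).sub
      ((hasDerivAt_id r).const_mul (Ψ 0 θ r₀))).congr_deriv (by simp)).hasDerivWithinAt)
    (fun r hr => (hball (y := (ε, r)) (by
      rw [Prod.dist_eq, max_lt_iff, Real.dist_eq, Real.dist_eq, sub_zero, abs_of_pos he]
      exact ⟨by linarith, (abs_le.2 ⟨by linarith [hr.1], by linarith [hr.2]⟩).trans_lt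
        (by linarith : κ < δ)⟩) θ hθ).le) hv hu
  rw [Real.norm_eq_abs, Real.norm_eq_abs] at this
  convert this using 2
  ring

/-- First order averaging for a scalar `2π`-periodic equation: a simple zero of the averaged
function yields, in a small band, a unique bounded solution, which is moreover periodic. -/
lemma exists_unique_periodic_of_averaging {Φ Ψ : ℝ → ℝ → ℝ → ℝ} {ε₁ κ₀ κ₁ r₀ : ℝ}
    (hε₁ : 0 < ε₁) (hκ₀ : 0 < κ₀) (hκ₁ : 0 < κ₁)
    (hΦ : ContinuousOn (fun z : ℝ × ℝ × ℝ => Φ z.1 z.2.1 z.2.2)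
      (Ioo (-ε₁) ε₁ ×ˢ univ ×ˢ Ioo (r₀ - κ₀) (r₀ + κ₀)))
    (hΨ : ContinuousOn (fun z : ℝ × ℝ × ℝ => Ψ z.1 z.2.1 z.2.2)
      (Ioo (-ε₁) ε₁ ×ˢ univ ×ˢ Ioo (r₀ - κ₀) (r₀ + κ₀)))
    (hder : ∀ ε ∈ Ioo (-ε₁) ε₁, ∀ θ, ∀ r ∈ Ioo (r₀ - κ₀) (r₀ + κ₀),
      HasDerivAt (Φ ε θ) (Ψ ε θ r) r)
    (hperΦ : ∀ ε θ r, Φ ε (θ + 2 * Real.pi) r = Φ ε θ r)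
    (hperΨ : ∀ ε θ r, Ψ ε (θ + 2 * Real.pi) r = Ψ ε θ r)
    (h0 : ∫ θ in (0 : ℝ)..2 * Real.pi, Φ 0 θ r₀ = 0)
    (hD : ∫ θ in (0 : ℝ)..2 * Real.pi, Ψ 0 θ r₀ ≠ 0) :
    ∃ κ, 0 < κ ∧ κ < κ₁ ∧ κ < κ₀ ∧ ∃ ε₀ > 0, ∀ ε, 0 < ε → ε ≤ ε₀ →
      (∃ r : ℝ → ℝ, Function.Periodic r (2 * Real.pi) ∧
        (∀ θ, r θ ∈ Ioo (r₀ - κ) (r₀ + κ)) ∧ ∀ θ, HasDerivAt r (ε * Φ ε θ (r θ)) θ) ∧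
      ∀ u v : ℝ → ℝ, (∀ θ, u θ ∈ Icc (r₀ - κ) (r₀ + κ)) → (∀ θ, v θ ∈ Icc (r₀ - κ) (r₀ + κ)) →
        (∀ θ, HasDerivAt u (ε * Φ ε θ (u θ)) θ) → (∀ θ, HasDerivAt v (ε * Φ ε θ (v θ)) θ) →
        u = v := by
  rcases hD.lt_or_gt with hD | hD
  swap
  · exact exists_unique_periodic_of_averaging_of_pos hε₁ hκ₀ hκ₁ hΦ hΨ hder hperΦ hperΨ h0 hD
  have hqint : ∀ h : ℝ → ℝ, Function.Periodic h (2 * Real.pi) →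
      ∫ θ in (0 : ℝ)..2 * Real.pi, -h (-θ) = -∫ θ in (0 : ℝ)..2 * Real.pi, h θ := by
    intro h hh
    have := Function.Periodic.intervalIntegral_add_eq hh (-(2 * Real.pi)) 0
    rw [neg_add_cancel, zero_add] at this
    rw [intervalIntegral.integral_neg, intervalIntegral.integral_comp_neg, neg_zero, this]
  have hcont : ContinuousOn (fun z : ℝ × ℝ × ℝ => ((z.1, -z.2.1, z.2.2) : ℝ × ℝ × ℝ))
      (Ioo (-ε₁) ε₁ ×ˢ univ ×ˢ Ioo (r₀ - κ₀) (r₀ + κ₀)) := by fun_prop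
  have hmaps : MapsTo (fun z : ℝ × ℝ × ℝ => ((z.1, -z.2.1, z.2.2) : ℝ × ℝ × ℝ))
      (Ioo (-ε₁) ε₁ ×ˢ univ ×ˢ Ioo (r₀ - κ₀) (r₀ + κ₀))
      (Ioo (-ε₁) ε₁ ×ˢ univ ×ˢ Ioo (r₀ - κ₀) (r₀ + κ₀)) := fun z hz => ⟨hz.1, trivial, hz.2.2⟩
  have hrev : ∀ h : ℝ → ℝ → ℝ → ℝ, (∀ ε θ r, h ε (θ + 2 * Real.pi) r = h ε θ r) →
      ∀ ε θ r, -h ε (-(θ + 2 * Real.pi)) r = -h ε (-θ) r := by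
    intro h hh ε θ r
    rw [← hh ε (-(θ + 2 * Real.pi)) r]; ring_nf
  obtain ⟨κ, hκ, hκ1, hκ0, ε₀, hε₀, H⟩ := exists_unique_periodic_of_averaging_of_pos
    (Φ := fun ε θ r => -Φ ε (-θ) r) (Ψ := fun ε θ r => -Ψ ε (-θ) r) hε₁ hκ₀ hκ₁
    (hΦ.comp hcont hmaps).neg (hΨ.comp hcont hmaps).neg
    (fun ε he θ r hr => (hder ε he (-θ) r hr).neg) (hrev Φ hperΦ) (hrev Ψ hperΨ)
    (by rw [hqint (fun θ => Φ 0 θ r₀) fun θ => hperΦ _ _ _, h0, neg_zero])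
    (by rw [hqint (fun θ => Ψ 0 θ r₀) fun θ => hperΨ _ _ _]; exact neg_pos.2 hD)
  have hflip : ∀ (ε : ℝ) (h : ℝ → ℝ), (∀ θ, HasDerivAt h (ε * Φ ε θ (h θ)) θ) → ∀ θ,
      HasDerivAt (fun θ => h (-θ)) (ε * -Φ ε (-θ) (h (-θ))) θ := fun ε h hh θ =>
    ((hh (-θ)).comp θ (hasDerivAt_neg θ)).congr_deriv (by ring)
  refine ⟨κ, hκ, hκ1, hκ0, ε₀, hε₀, fun ε he hle => ?_⟩
  obtain ⟨⟨r, hr1, hr2, hr3⟩, hu⟩ := H ε he hle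
  refine ⟨⟨fun θ => r (-θ), fun θ => ?_, fun θ => hr2 _, fun θ => ?_⟩,
    fun u v hum hvm hu' hv' => ?_⟩
  · have := hr1 (-(θ + 2 * Real.pi))
    simp only [← this]; ring_nf
  · exact ((hr3 (-θ)).comp θ (hasDerivAt_neg θ)).congr_deriv (by rw [neg_neg]; ring)
  · have := hu (fun θ => u (-θ)) (fun θ => v (-θ)) (fun θ => hum _) (fun θ => hvm _)
      (hflip ε u hu') (hflip ε v hv')
    funext θ
    simpa using congrFun this (-θ)

lemma mul_sin_mem_Ioo {ρ r : ℝ} (hr : r ∈ Ioo (-ρ) ρ) (θ : ℝ) : r * Real.sin θ ∈ Ioo (-ρ) ρ := by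
  rw [mem_Ioo, ← abs_lt] at hr
  rw [mem_Ioo, ← abs_lt, abs_mul]
  exact (mul_le_of_le_one_right (abs_nonneg r) (Real.abs_sin_le_one θ)).trans_lt hr

lemma exists_bound_comp_mul_sin {h : ℝ → ℝ} {ρ r : ℝ} (hh : ContinuousOn h (Ioo (-ρ) ρ))
    (hr : r ∈ Ioo (-ρ) ρ) : ∃ B, ∀ᶠ x in 𝓝 r, ∀ θ, |h (x * Real.sin θ)| ≤ B := by
  obtain ⟨ρ', h1, h2⟩ := exists_between (abs_lt.2 hr)
  obtain ⟨B, hB⟩ := isCompact_Icc.exists_bound_of_continuousOn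
    (hh.mono (Icc_subset_Ioo (neg_lt_neg h2) h2))
  refine ⟨B, ?_⟩
  filter_upwards [isOpen_Ioo.mem_nhds (abs_lt.1 h1)] with x hx θ
  exact hB _ (Ioo_subset_Icc_self (mul_sin_mem_Ioo hx θ))

lemma continuous_comp_mul_sin {h : ℝ → ℝ} {ρ r : ℝ} (hh : ContinuousOn h (Ioo (-ρ) ρ))
    (hr : r ∈ Ioo (-ρ) ρ) : Continuous fun θ => h (r * Real.sin θ) :=
  hh.comp_continuous (by fun_prop) (mul_sin_mem_Ioo hr)

lemma continuousOn_integral_comp_mul_sin {w h : ℝ → ℝ} {ρ : ℝ} (hw : Continuous w)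
    (hh : ContinuousOn h (Ioo (-ρ) ρ)) :
    ContinuousOn (fun r => ∫ θ in (0 : ℝ)..2 * Real.pi, w θ * h (r * Real.sin θ))
      (Ioo (-ρ) ρ) := by
  intro r hr
  obtain ⟨B, hB⟩ := exists_bound_comp_mul_sin hh hr
  have hIoo := isOpen_Ioo.mem_nhds hr
  refine (intervalIntegral.continuousAt_of_dominated_interval (bound := fun θ => |w θ| * B)
    ?_ ?_ ?_ ?_).continuousWithinAt
  · filter_upwards [hIoo] with x hx
    exact (hw.mul (continuous_comp_mul_sin hh hx)).aestronglyMeasurable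
  · filter_upwards [hB] with x hx
    refine Eventually.of_forall fun θ _ => ?_
    rw [Real.norm_eq_abs, abs_mul]
    exact mul_le_mul_of_nonneg_left (hx θ) (abs_nonneg _)
  · exact Continuous.intervalIntegrable (by fun_prop) _ _
  · refine Eventually.of_forall fun θ _ => ?_
    exact continuousAt_const.mul (ContinuousAt.comp (f := fun x => x * Real.sin θ)
      (hh.continuousAt (isOpen_Ioo.mem_nhds (mul_sin_mem_Ioo hr θ))) (by fun_prop))

lemma hasDerivAt_integral_comp_mul_sin {w k : ℝ → ℝ} {ρ r : ℝ} (hw : Continuous w)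
    (hk : ContDiffOn ℝ 1 k (Ioo (-ρ) ρ)) (hr : r ∈ Ioo (-ρ) ρ) :
    HasDerivAt (fun r => ∫ θ in (0 : ℝ)..2 * Real.pi, w θ * k (r * Real.sin θ))
      (∫ θ in (0 : ℝ)..2 * Real.pi, w θ * Real.sin θ * deriv k (r * Real.sin θ)) r := by
  have hk' : ContinuousOn (deriv k) (Ioo (-ρ) ρ) := hk.continuousOn_deriv_of_isOpen isOpen_Ioo
    le_rfl
  obtain ⟨B, hB⟩ := exists_bound_comp_mul_sin hk' hr
  have hIoo := isOpen_Ioo.mem_nhds hr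
  refine (intervalIntegral.hasDerivAt_integral_of_dominated_loc_of_deriv_le
    (bound := fun θ => |w θ| * |Real.sin θ| * B)
    (F' := fun r θ => w θ * Real.sin θ * deriv k (r * Real.sin θ))
    (inter_mem hIoo hB) ?_ ?_ ?_ ?_ ?_ ?_).2
  · filter_upwards [hIoo] with x hx
    exact (hw.mul (continuous_comp_mul_sin hk.continuousOn hx)).aestronglyMeasurable
  · exact (hw.mul (continuous_comp_mul_sin hk.continuousOn hr)).intervalIntegrable _ _
  · exact ((hw.mul Real.continuous_sin).mul
      (continuous_comp_mul_sin hk' hr)).aestronglyMeasurable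
  · refine Eventually.of_forall fun θ _ x hx => ?_
    rw [Real.norm_eq_abs, abs_mul, abs_mul]
    exact mul_le_mul_of_nonneg_left (hx.2 θ) (by positivity)
  · exact Continuous.intervalIntegrable (by fun_prop) _ _
  · refine Eventually.of_forall fun θ _ x hx => ?_
    have h1 : HasDerivAt k (deriv k (x * Real.sin θ)) (x * Real.sin θ) :=
      (hk.differentiableOn one_ne_zero).hasDerivAt
        (isOpen_Ioo.mem_nhds (mul_sin_mem_Ioo hx.1 θ))
    exact ((h1.comp x ((hasDerivAt_id x).mul_const (Real.sin θ))).const_mul (w θ)).congr_deriv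
      (by ring)

lemma contDiffOn_integral_comp_mul_sin {w k : ℝ → ℝ} {ρ : ℝ} (hw : Continuous w)
    (hk : ContDiffOn ℝ 1 k (Ioo (-ρ) ρ)) :
    ContDiffOn ℝ 1 (fun r => ∫ θ in (0 : ℝ)..2 * Real.pi, w θ * k (r * Real.sin θ))
      (Ioo (-ρ) ρ) := by
  rw [show (1 : WithTop ℕ∞) = 0 + 1 from (zero_add 1).symm,
    contDiffOn_succ_iff_deriv_of_isOpen isOpen_Ioo]
  refine ⟨fun r hr => (hasDerivAt_integral_comp_mul_sin hw hk hr).differentiableAt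
    |>.differentiableWithinAt, by simp, contDiffOn_zero.2 ?_⟩
  have hk' : ContinuousOn (deriv k) (Ioo (-ρ) ρ) := hk.continuousOn_deriv_of_isOpen isOpen_Ioo
    le_rfl
  refine (continuousOn_integral_comp_mul_sin (hw.mul Real.continuous_sin) hk').congr ?_
  intro r hr
  exact (hasDerivAt_integral_comp_mul_sin hw hk hr).deriv

/-- The first order Melnikov function of the damping `k` (written in the energy variable). -/
noncomputable def melnikov (k : ℝ → ℝ) (r : ℝ) : ℝ :=
  ∫ θ in (0 : ℝ)..2 * Real.pi, Real.cos θ ^ 2 * k (r * Real.sin θ)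

lemma contDiffOn_melnikov {k : ℝ → ℝ} {ρ : ℝ} (hk : ContDiffOn ℝ 1 k (Ioo (-ρ) ρ)) :
    ContDiffOn ℝ 1 (melnikov k) (Ioo (-ρ) ρ) :=
  contDiffOn_integral_comp_mul_sin (by fun_prop) hk

/-- Right-hand side (divided by `ε`) of the equation `dr/dθ` in the polar energy variables. -/
noncomputable def polarField (k : ℝ → ℝ) (ε θ r : ℝ) : ℝ :=
  -(r * k (r * Real.sin θ) * Real.cos θ ^ 2) /
    (1 + ε * k (r * Real.sin θ) * (Real.sin θ * Real.cos θ))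

lemma exists_unique_periodic_polarField {k : ℝ → ℝ} {ρ r₀ κ₁ : ℝ}
    (hk : ContDiffOn ℝ 1 k (Ioo (-ρ) ρ)) (hr₀ : r₀ ∈ Ioo 0 ρ) (hκ₁ : 0 < κ₁)
    (h0 : melnikov k r₀ = 0) (h1 : deriv (melnikov k) r₀ ≠ 0) :
    ∃ κ, 0 < κ ∧ κ < κ₁ ∧ κ < r₀ ∧ r₀ + κ < ρ ∧ ∃ ε₀ > 0, ∀ ε, 0 < ε → ε ≤ ε₀ →
      (∀ s ∈ Icc (-(r₀ + κ)) (r₀ + κ), |ε * k s| ≤ 1 / 2) ∧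
      (∃ r : ℝ → ℝ, Function.Periodic r (2 * Real.pi) ∧
        (∀ θ, r θ ∈ Ioo (r₀ - κ) (r₀ + κ)) ∧
        ∀ θ, HasDerivAt r (ε * polarField k ε θ (r θ)) θ) ∧
      ∀ u v : ℝ → ℝ, (∀ θ, u θ ∈ Icc (r₀ - κ) (r₀ + κ)) → (∀ θ, v θ ∈ Icc (r₀ - κ) (r₀ + κ)) →
        (∀ θ, HasDerivAt u (ε * polarField k ε θ (u θ)) θ) →
        (∀ θ, HasDerivAt v (ε * polarField k ε θ (v θ)) θ) → u = v := by
  have hk' : ContinuousOn (deriv k) (Ioo (-ρ) ρ) := hk.continuousOn_deriv_of_isOpen isOpen_Ioo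
    le_rfl
  set κ₀ := min (r₀ / 2) ((ρ - r₀) / 2) with hκ₀
  have hρr : 0 < ρ - r₀ := sub_pos.2 hr₀.2
  have hr₀0 : 0 < r₀ := hr₀.1
  have hκ₀pos : 0 < κ₀ := lt_min (by positivity) (by positivity)
  have hκ₀1 : κ₀ ≤ r₀ / 2 := min_le_left _ _
  have hκ₀2 : κ₀ ≤ (ρ - r₀) / 2 := min_le_right _ _
  obtain ⟨B, hB⟩ := isCompact_Icc.exists_bound_of_continuousOn (hk.continuousOn.mono
    (show Icc (-(r₀ + κ₀)) (r₀ + κ₀) ⊆ Ioo (-ρ) ρ from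
      Icc_subset_Ioo (by linarith) (by linarith)))
  simp only [Real.norm_eq_abs] at hB
  have hB0 : 0 ≤ B := (abs_nonneg _).trans (hB 0 ⟨by linarith, by linarith⟩)
  set ε₁ := 1 / (2 * (B + 1)) with hε₁
  have hε₁pos : 0 < ε₁ := by positivity
  have hεB : ∀ ε, |ε| ≤ ε₁ → ∀ s ∈ Icc (-(r₀ + κ₀)) (r₀ + κ₀), |ε * k s| ≤ 1 / 2 := by
    intro ε hε s hs
    rw [abs_mul]
    calc _ ≤ ε₁ * B := mul_le_mul hε (hB s hs) (abs_nonneg _) hε₁pos.le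
      _ ≤ 1 / 2 := by
        rw [hε₁, div_mul_eq_mul_div, div_le_div_iff₀ (by positivity) (by positivity)]
        linarith
  have hrs : ∀ r ∈ Ioo (r₀ - κ₀) (r₀ + κ₀), r ∈ Ioo (-ρ) ρ := fun r hr =>
    ⟨by linarith [hr.1], by linarith [hr.2]⟩
  have hden : ∀ ε ∈ Ioo (-ε₁) ε₁, ∀ θ, ∀ r ∈ Ioo (r₀ - κ₀) (r₀ + κ₀),
      0 < 1 + ε * k (r * Real.sin θ) * (Real.sin θ * Real.cos θ) := by
    intro ε hε θ r hr
    have e1 := hεB ε (abs_le.2 ⟨hε.1.le, hε.2.le⟩) (r * Real.sin θ)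
      (Ioo_subset_Icc_self (mul_sin_mem_Ioo ⟨by linarith [hr.1], hr.2⟩ θ))
    have e2 : |ε * k (r * Real.sin θ) * (Real.sin θ * Real.cos θ)| ≤ 1 / 2 * 1 := by
      rw [abs_mul]
      refine mul_le_mul e1 ?_ (abs_nonneg _) (by norm_num)
      rw [abs_mul]
      exact mul_le_one₀ (Real.abs_sin_le_one θ) (abs_nonneg _) (Real.abs_cos_le_one θ)
    linarith [(abs_le.1 e2).1]
  have hcomp : ∀ h : ℝ → ℝ, ContinuousOn h (Ioo (-ρ) ρ) →
      ContinuousOn (fun z : ℝ × ℝ × ℝ => h (z.2.2 * Real.sin z.2.1))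
        (Ioo (-ε₁) ε₁ ×ˢ univ ×ˢ Ioo (r₀ - κ₀) (r₀ + κ₀)) := fun h hh =>
    hh.comp (by fun_prop) fun z hz => mul_sin_mem_Ioo (hrs _ hz.2.2) _
  have ck := hcomp k hk.continuousOn
  have ck' := hcomp _ hk'
  have ce : ContinuousOn (fun z : ℝ × ℝ × ℝ => z.1)
      (Ioo (-ε₁) ε₁ ×ˢ univ ×ˢ Ioo (r₀ - κ₀) (r₀ + κ₀)) := continuousOn_fst
  have cr : ContinuousOn (fun z : ℝ × ℝ × ℝ => z.2.2)
      (Ioo (-ε₁) ε₁ ×ˢ univ ×ˢ Ioo (r₀ - κ₀) (r₀ + κ₀)) :=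
    (continuous_snd.comp continuous_snd).continuousOn
  have cs : ContinuousOn (fun z : ℝ × ℝ × ℝ => Real.sin z.2.1)
      (Ioo (-ε₁) ε₁ ×ˢ univ ×ˢ Ioo (r₀ - κ₀) (r₀ + κ₀)) := by fun_prop
  have cc : ContinuousOn (fun z : ℝ × ℝ × ℝ => Real.cos z.2.1)
      (Ioo (-ε₁) ε₁ ×ˢ univ ×ˢ Ioo (r₀ - κ₀) (r₀ + κ₀)) := by fun_prop
  have cnum := ((cr.mul ck).mul (cc.pow 2)).neg
  have cden := (continuousOn_const (c := (1 : ℝ))).add ((ce.mul ck).mul (cs.mul cc))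
  have hdm := hasDerivAt_integral_comp_mul_sin (w := fun θ => Real.cos θ ^ 2) (by fun_prop) hk
    (hrs r₀ ⟨by linarith, by linarith⟩)
  have ck₀ := continuous_comp_mul_sin hk.continuousOn (hrs r₀ ⟨by linarith, by linarith⟩)
  have ck₀' := continuous_comp_mul_sin hk' (hrs r₀ ⟨by linarith, by linarith⟩)
  have main := fun hΦ hΨ hder hperΦ hperΨ hi0 hiD =>
    exists_unique_periodic_of_averaging (Φ := polarField k)
    (Ψ := fun ε θ r =>
      (-((k (r * Real.sin θ) + r * (Real.sin θ * deriv k (r * Real.sin θ))) * Real.cos θ ^ 2) *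
        (1 + ε * k (r * Real.sin θ) * (Real.sin θ * Real.cos θ)) -
        -(r * k (r * Real.sin θ) * Real.cos θ ^ 2) *
          (ε * (Real.sin θ * deriv k (r * Real.sin θ)) * (Real.sin θ * Real.cos θ))) /
        (1 + ε * k (r * Real.sin θ) * (Real.sin θ * Real.cos θ)) ^ 2)
    (r₀ := r₀) hε₁pos hκ₀pos hκ₁ hΦ hΨ hder hperΦ hperΨ hi0 hiD
  refine Exists.elim (main ?_ ?_ ?_ ?_ ?_ ?_ ?_) ?_
  · refine cnum.div cden fun z hz => ?_
    exact (hden _ hz.1 _ _ hz.2.2).ne'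
  · refine ((((ck.add (cr.mul (cs.mul ck'))).mul (cc.pow 2)).neg.mul cden).sub
      (cnum.mul ((ce.mul (cs.mul ck')).mul (cs.mul cc)))).div (cden.pow 2) fun z hz => ?_
    exact (pow_pos (hden _ hz.1 z.2.1 _ hz.2.2) 2).ne'
  · intro ε he θ r hr
    have hkd : HasDerivAt (fun r => k (r * Real.sin θ))
        (Real.sin θ * deriv k (r * Real.sin θ)) r :=
      (((hk.differentiableOn one_ne_zero).hasDerivAt
        (isOpen_Ioo.mem_nhds (mul_sin_mem_Ioo (hrs r hr) θ))).comp r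
          ((hasDerivAt_id r).mul_const (Real.sin θ))).congr_deriv (by ring)
    refine (((((hasDerivAt_id r).mul hkd).mul_const (Real.cos θ ^ 2)).neg.div
      (((hkd.const_mul ε).mul_const (Real.sin θ * Real.cos θ)).const_add 1)
      (hden ε he θ r hr).ne')).congr_deriv ?_
    simp
  · intro ε θ r
    simp only [polarField, Real.sin_add_two_pi, Real.cos_add_two_pi]
  · intro ε θ r
    simp only [Real.sin_add_two_pi, Real.cos_add_two_pi]
  · refine Eq.trans ?_ (show -r₀ * melnikov k r₀ = 0 by rw [h0, mul_zero])
    rw [melnikov, ← intervalIntegral.integral_const_mul]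
    refine intervalIntegral.integral_congr fun θ _ => ?_
    simp only [polarField]; ring
  · have : deriv (melnikov k) r₀ = _ := hdm.deriv
    rw [this] at h1
    convert mul_ne_zero (neg_ne_zero.2 hr₀0.ne') h1 using 1
    refine Eq.trans ?_ (sub_zero (-r₀ * _))
    refine Eq.trans ?_ (congrArg _ h0)
    rw [melnikov, ← intervalIntegral.integral_const_mul, ← intervalIntegral.integral_sub]
    · refine intervalIntegral.integral_congr fun θ _ => ?_
      ring
    · exact Continuous.intervalIntegrable (by fun_prop) _ _
    · exact ((Real.continuous_cos.pow 2).mul ck₀).intervalIntegrable _ _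
  · rintro κ ⟨a1, a2, a3, ε₀, a4, a5⟩
    refine ⟨κ, a1, a2, by linarith, by linarith, min ε₀ ε₁, by positivity, fun ε he hle =>
      ⟨fun s hs => hεB ε ?_ s ⟨by linarith [hs.1], by linarith [hs.2]⟩,
        a5 ε he (hle.trans (min_le_left _ _))⟩⟩
    rw [abs_of_pos he]; exact hle.trans (min_le_right _ _)

lemma exists_inverse_of_deriv_ge {T w : ℝ → ℝ} {c : ℝ} (hc : 0 < c)
    (hT : ∀ θ, HasDerivAt T (w θ) θ) (hw : ∀ θ, c ≤ w θ) :
    ∃ τ : ℝ → ℝ, LeftInverse τ T ∧ RightInverse τ T ∧ ∀ t, HasDerivAt τ (w (τ t))⁻¹ t := by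
  have hmono : StrictMono T := strictMono_of_hasDerivAt_pos hT fun θ => hc.trans_le (hw θ)
  have hcont : Continuous T := continuous_iff_continuousAt.2 fun θ => (hT θ).continuousAt
  have hlow : Monotone fun θ => T θ - c * θ :=
    monotone_of_hasDerivAt_nonneg (f' := fun θ => w θ - c)
      (fun θ => ((hT θ).sub ((hasDerivAt_id θ).const_mul c)).congr_deriv (by simp))
      fun θ => sub_nonneg.2 (hw θ)
  have hsurj : Surjective T := by
    refine hcont.surjective ?_ ?_
    · refine tendsto_atTop_mono' atTop (f₁ := fun θ => c * θ + (T 0 - c * 0)) ?_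
        (tendsto_atTop_add_const_right _ _ (tendsto_id.const_mul_atTop hc))
      filter_upwards [eventually_ge_atTop 0] with θ hθ
      have := hlow hθ; simp only at this; linarith
    · refine tendsto_atBot_mono' atBot (f₂ := T) (f₁ := fun θ => c * θ + (T 0 - c * 0)) ?_
        (tendsto_atBot_add_const_right _ _ (tendsto_id.const_mul_atBot hc))
      filter_upwards [eventually_le_atBot 0] with θ hθ
      have := hlow hθ; simp only at this; linarith
  let e := hmono.orderIsoOfSurjective T hsurj
  have hR : RightInverse e.symm T := e.apply_symm_apply
  refine ⟨e.symm, e.symm_apply_apply, hR, fun t => ?_⟩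
  exact HasDerivAt.of_local_left_inverse e.symm.continuous.continuousAt (hT _)
    (hc.trans_le (hw _)).ne' (Eventually.of_forall hR)

lemma exists_periodic_solution_of_reparametrization {E : Type*} [NormedAddCommGroup E]
    [NormedSpace ℝ E] {V : E → E} {c : ℝ → E} {w : ℝ → ℝ} {P : ℝ} (hP : 0 < P)
    (hw : Continuous w) (hwpos : ∀ θ, 0 < w θ) (hwper : Function.Periodic w P)
    (hcper : Function.Periodic c P) (hc : ∀ θ, HasDerivAt c (w θ • V (c θ)) θ) :
    ∃ γ : ℝ → E, (∀ t, HasDerivAt γ (V (γ t)) t) ∧ (∃ T, 0 < T ∧ Function.Periodic γ T) ∧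
      range γ = range c := by
  obtain ⟨a, ha, hmin⟩ : ∃ a, 0 < a ∧ ∀ θ, a ≤ w θ := by
    obtain ⟨x, -, hx⟩ := isCompact_Icc.exists_isMinOn (nonempty_Icc.2 hP.le) hw.continuousOn
    exact ⟨w x, hwpos x, Function.Periodic.forall_of_forall_mem_Icc hP
      (fun θ => by simp only [hwper θ]) fun θ hθ => hx hθ⟩
  have hT : ∀ θ, HasDerivAt (fun θ => ∫ u in (0 : ℝ)..θ, w u) (w θ) θ := fun θ =>
    (hw.integral_hasStrictDerivAt 0 θ).hasDerivAt
  obtain ⟨τ, hl, hr, hτ⟩ := exists_inverse_of_deriv_ge ha hT hmin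
  refine ⟨c ∘ τ, fun t => ?_, ⟨∫ u in (0 : ℝ)..P, w u, ?_, fun t => ?_⟩, ?_⟩
  · refine ((hc (τ t)).scomp t (hτ t)).congr_deriv ?_
    rw [smul_smul, inv_mul_cancel₀ (hwpos _).ne', one_smul]; rfl
  · exact intervalIntegral.intervalIntegral_pos_of_pos (hw.intervalIntegrable _ _) hwpos hP
  · have : τ (t + ∫ u in (0 : ℝ)..P, w u) = τ t + P := by
      have h1 : (∫ u in (0 : ℝ)..τ t, w u) + ∫ u in τ t..(τ t + P), w u =
          ∫ u in (0 : ℝ)..(τ t + P), w u :=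
        intervalIntegral.integral_add_adjacent_intervals (hw.intervalIntegrable _ _)
          (hw.intervalIntegrable _ _)
      have h2 : ∫ u in (0 : ℝ)..τ t, w u = t := hr t
      rw [hwper.intervalIntegral_add_eq (τ t) 0, zero_add, h2] at h1
      rw [h1]
      exact hl (τ t + P)
    simp only [Function.comp_apply, this, hcper (τ t)]
  · exact hl.surjective.range_comp c

/-- A differentiable plane curve avoiding the origin has polar coordinates. -/
lemma exists_polar_angle {s y s' y' : ℝ → ℝ} (hs : ∀ t, HasDerivAt s (s' t) t)
    (hy : ∀ t, HasDerivAt y (y' t) t) (cs : Continuous s') (cy : Continuous y')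
    (hpos : ∀ t, 0 < s t ^ 2 + y t ^ 2) :
    ∃ θ : ℝ → ℝ, ∀ t, HasDerivAt θ ((s' t * y t - s t * y' t) / (s t ^ 2 + y t ^ 2)) t ∧
      s t = √(s t ^ 2 + y t ^ 2) * Real.sin (θ t) ∧
      y t = √(s t ^ 2 + y t ^ 2) * Real.cos (θ t) := by
  have c1 : Continuous s := continuous_iff_continuousAt.2 fun t => (hs t).continuousAt
  have c2 : Continuous y := continuous_iff_continuousAt.2 fun t => (hy t).continuousAt
  set ω : ℝ → ℝ := fun t => (s' t * y t - s t * y' t) / (s t ^ 2 + y t ^ 2) with hω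
  have cω : Continuous ω := Continuous.div (by fun_prop) (by fun_prop) fun t => (hpos t).ne'
  obtain ⟨θ₀, h1, h2⟩ : ∃ θ₀, s 0 = √(s 0 ^ 2 + y 0 ^ 2) * Real.sin θ₀ ∧
      y 0 = √(s 0 ^ 2 + y 0 ^ 2) * Real.cos θ₀ := by
    have hn : ‖(⟨y 0, s 0⟩ : ℂ)‖ = √(s 0 ^ 2 + y 0 ^ 2) := by
      rw [Complex.norm_def, Complex.normSq_apply]; congr 1; ring
    refine ⟨Complex.arg ⟨y 0, s 0⟩, ?_, ?_⟩
    · rw [← hn, Complex.norm_mul_sin_arg]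
    · rw [← hn, Complex.norm_mul_cos_arg]
  set θ : ℝ → ℝ := fun t => θ₀ + ∫ u in (0 : ℝ)..t, ω u with hθ
  have dθ : ∀ t, HasDerivAt θ (ω t) t := fun t =>
    ((cω.integral_hasStrictDerivAt 0 t).hasDerivAt).const_add θ₀
  set R : ℝ → ℝ := fun t => √(s t ^ 2 + y t ^ 2) with hR
  have Rpos : ∀ t, 0 < R t := fun t => Real.sqrt_pos.2 (hpos t)
  have Rsq : ∀ t, R t ^ 2 = s t ^ 2 + y t ^ 2 := fun t => Real.sq_sqrt (hpos t).le
  have dR : ∀ t, HasDerivAt R ((s t * s' t + y t * y' t) / R t) t := fun t => by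
    refine ((((hs t).pow 2).add ((hy t).pow 2)).sqrt (hpos t).ne').congr_deriv ?_
    have := (Rpos t).ne'
    simp only [hR] at this ⊢
    simp only [Pi.add_apply, Pi.pow_apply]
    field_simp
    push_cast; ring
  have ds := fun t => (dθ t).sin
  have dc := fun t => (dθ t).cos
  have hA : ∀ t, (s t * Real.cos (θ t) - y t * Real.sin (θ t)) / R t = 0 := by
    have hd : ∀ t, HasDerivAt (fun t => (s t * Real.cos (θ t) - y t * Real.sin (θ t)) / R t)
        0 t := fun t => by
      refine ((((hs t).mul (dc t)).sub ((hy t).mul (ds t))).div (dR t)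
        (Rpos t).ne').congr_deriv ?_
      have := (Rpos t).ne'
      simp only [hω, Pi.sub_apply, Pi.mul_apply]
      rw [← Rsq]
      field_simp
      rw [Rsq]; ring
    intro t
    rw [is_const_of_deriv_eq_zero (fun t => (hd t).differentiableAt) (fun t => (hd t).deriv) t 0]
    have : θ 0 = θ₀ := by simp [hθ]
    rw [this]
    change s 0 = R 0 * _ at h1
    change y 0 = R 0 * _ at h2
    rw [h1, h2]; ring
  have hB : ∀ t, (s t * Real.sin (θ t) + y t * Real.cos (θ t)) / R t = 1 := by
    have hd : ∀ t, HasDerivAt (fun t => (s t * Real.sin (θ t) + y t * Real.cos (θ t)) / R t)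
        0 t := fun t => by
      refine ((((hs t).mul (ds t)).add ((hy t).mul (dc t))).div (dR t)
        (Rpos t).ne').congr_deriv ?_
      have := (Rpos t).ne'
      simp only [hω, Pi.add_apply, Pi.mul_apply]
      rw [← Rsq]
      field_simp
      rw [Rsq]; ring
    intro t
    rw [is_const_of_deriv_eq_zero (fun t => (hd t).differentiableAt) (fun t => (hd t).deriv) t 0]
    have : θ 0 = θ₀ := by simp [hθ]
    rw [this]
    change s 0 = R 0 * _ at h1
    change y 0 = R 0 * _ at h2
    have h0 := (Rpos 0).ne'
    rw [h1, h2]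
    field_simp
    exact Real.sin_sq_add_cos_sq θ₀
  refine ⟨θ, fun t => ⟨dθ t, ?_, ?_⟩⟩
  · have a := hA t; have b := hB t
    rw [div_eq_iff (Rpos t).ne'] at a b
    change s t = R t * _
    linear_combination Real.cos (θ t) * a + Real.sin (θ t) * b -
      s t * Real.sin_sq_add_cos_sq (θ t)
  · have a := hA t; have b := hB t
    rw [div_eq_iff (Rpos t).ne'] at a b
    change y t = R t * _
    linear_combination -Real.sin (θ t) * a + Real.cos (θ t) * b -
      y t * Real.sin_sq_add_cos_sq (θ t)

/-- `ξ` is a coordinate in which the potential with derivative `g` becomes `s ^ 2 / 2`. -/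
structure EnergyChart (g : ℝ[X]) (ρ : ℝ) (ξ ξ' : ℝ → ℝ) : Prop where
  pos : 0 < ρ
  hasDerivAt : ∀ s ∈ Ioo (-ρ) ρ, HasDerivAt ξ (ξ' s) s
  contDiffOn : ContDiffOn ℝ 1 ξ' (Ioo (-ρ) ρ)
  deriv_pos : ∀ s ∈ Ioo (-ρ) ρ, 0 < ξ' s
  energy : ∀ s ∈ Ioo (-ρ) ρ, g.eval (ξ s) * ξ' s = s

/-- The damping written in the energy coordinate. -/
noncomputable def damping (f : ℝ[X]) (ξ ξ' : ℝ → ℝ) (s : ℝ) : ℝ := f.eval (ξ s) * ξ' s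

/-- The union of the level curves of the energy with radii in `V`. -/
def energyAnnulus (ξ : ℝ → ℝ) (V : Set ℝ) : Set (ℝ × ℝ) :=
  {p | ∃ r ∈ V, ∃ θ, p = (ξ (r * Real.sin θ), r * Real.cos θ)}

namespace EnergyChart

variable {f g : ℝ[X]} {ρ : ℝ} {ξ ξ' : ℝ → ℝ}

lemma continuousOn (h : EnergyChart g ρ ξ ξ') : ContinuousOn ξ (Ioo (-ρ) ρ) :=
  fun s hs => (h.hasDerivAt s hs).continuousAt.continuousWithinAt

lemma contDiffOn_one (h : EnergyChart g ρ ξ ξ') : ContDiffOn ℝ 1 ξ (Ioo (-ρ) ρ) := by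
  rw [show (1 : WithTop ℕ∞) = 0 + 1 from (zero_add 1).symm,
    contDiffOn_succ_iff_deriv_of_isOpen isOpen_Ioo]
  exact ⟨fun s hs => (h.hasDerivAt s hs).differentiableAt.differentiableWithinAt, by simp,
    contDiffOn_zero.2 (h.contDiffOn.continuousOn.congr fun s hs => (h.hasDerivAt s hs).deriv)⟩

lemma contDiffOn_damping (h : EnergyChart g ρ ξ ξ') (f : ℝ[X]) :
    ContDiffOn ℝ 1 (damping f ξ ξ') (Ioo (-ρ) ρ) :=
  ((f.contDiff_aeval 1).comp_contDiffOn h.contDiffOn_one).mul h.contDiffOn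

lemma strictMonoOn (h : EnergyChart g ρ ξ ξ') : StrictMonoOn ξ (Ioo (-ρ) ρ) := by
  refine strictMonoOn_of_deriv_pos (convex_Ioo _ _) h.continuousOn fun s hs => ?_
  rw [interior_Ioo] at hs
  rw [(h.hasDerivAt s hs).deriv]
  exact h.deriv_pos s hs

lemma exists_inverse (h : EnergyChart g ρ ξ ξ') : IsOpen (ξ '' Ioo (-ρ) ρ) ∧
    ∃ S : ℝ → ℝ, ∀ s ∈ Ioo (-ρ) ρ, S (ξ s) = s ∧ HasDerivAt S (ξ' s)⁻¹ (ξ s) := by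
  have hstrict : ∀ s ∈ Ioo (-ρ) ρ, HasStrictDerivAt ξ (ξ' s) s := fun s hs => by
    refine hasStrictDerivAt_of_hasDerivAt_of_continuousAt ?_
      (h.contDiffOn.continuousOn.continuousAt (isOpen_Ioo.mem_nhds hs))
    filter_upwards [isOpen_Ioo.mem_nhds hs] with x hx using h.hasDerivAt x hx
  have hinv : ∀ s ∈ Ioo (-ρ) ρ, invFunOn ξ (Ioo (-ρ) ρ) (ξ s) = s := fun s hs =>
    h.strictMonoOn.injOn.leftInvOn_invFunOn hs
  refine ⟨isOpen_iff_mem_nhds.2 ?_, invFunOn ξ (Ioo (-ρ) ρ), fun s hs => ⟨hinv s hs, ?_⟩⟩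
  · rintro _ ⟨s, hs, rfl⟩
    rw [← (hstrict s hs).map_nhds_eq (h.deriv_pos s hs).ne']
    exact image_mem_map (isOpen_Ioo.mem_nhds hs)
  · refine ((hstrict s hs).to_local_left_inverse (h.deriv_pos s hs).ne' ?_).hasDerivAt
    filter_upwards [isOpen_Ioo.mem_nhds hs] with x hx using hinv x hx

/-- The level curves perturbed by a periodic solution of the polar equation form an orbit. -/
lemma isPeriodicOrbit (h : EnergyChart g ρ ξ ξ') {ε a b : ℝ} (ha : 0 < a) (hb : b < ρ)
    (hε : ∀ s ∈ Icc (-b) b, |ε * damping f ξ ξ' s| ≤ 1 / 2)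
    {r : ℝ → ℝ} (hper : Function.Periodic r (2 * Real.pi)) (hr : ∀ θ, r θ ∈ Ioo a b)
    (hder : ∀ θ, HasDerivAt r (ε * polarField (damping f ξ ξ') ε θ (r θ)) θ) :
    IsPeriodicOrbit (lienard f g ε)
      (range fun θ => (ξ (r θ * Real.sin θ), r θ * Real.cos θ)) := by
  set k := damping f ξ ξ' with hk
  have hmem' : ∀ θ, r θ * Real.sin θ ∈ Ioo (-b) b := fun θ =>
    mul_sin_mem_Ioo ⟨by linarith [(hr θ).1, (hr θ).2], (hr θ).2⟩ θ
  have hmem : ∀ θ, r θ * Real.sin θ ∈ Ioo (-ρ) ρ := fun θ =>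
    ⟨by linarith [(hmem' θ).1], by linarith [(hmem' θ).2]⟩
  have hden : ∀ θ, 0 < 1 + ε * k (r θ * Real.sin θ) * (Real.sin θ * Real.cos θ) := by
    intro θ
    have e2 : |ε * k (r θ * Real.sin θ) * (Real.sin θ * Real.cos θ)| ≤ 1 / 2 * 1 := by
      rw [abs_mul]
      refine mul_le_mul (hε _ (Ioo_subset_Icc_self (hmem' θ))) ?_ (abs_nonneg _) (by norm_num)
      rw [abs_mul]
      exact mul_le_one₀ (Real.abs_sin_le_one θ) (abs_nonneg _) (Real.abs_cos_le_one θ)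
    linarith [(abs_le.1 e2).1]
  have cr : Continuous r := continuous_iff_continuousAt.2 fun t => (hder t).continuousAt
  have cs : Continuous fun θ => r θ * Real.sin θ := by fun_prop
  have ck : Continuous fun θ => k (r θ * Real.sin θ) :=
    (h.contDiffOn_damping f).continuousOn.comp_continuous cs hmem
  have cξ' : Continuous fun θ => ξ' (r θ * Real.sin θ) :=
    h.contDiffOn.continuousOn.comp_continuous cs hmem
  obtain ⟨γ, h1, h2, h3⟩ := exists_periodic_solution_of_reparametrization
    (V := lienard f g ε) (c := fun θ => (ξ (r θ * Real.sin θ), r θ * Real.cos θ))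
    (w := fun θ => ξ' (r θ * Real.sin θ) /
      (1 + ε * k (r θ * Real.sin θ) * (Real.sin θ * Real.cos θ))) Real.two_pi_pos
    (cξ'.div (continuous_const.add ((continuous_const.mul ck).mul
      (Real.continuous_sin.mul Real.continuous_cos))) fun θ => (hden θ).ne')
    (fun θ => div_pos (h.deriv_pos _ (hmem θ)) (hden θ))
    (fun θ => by simp only [hper θ, Real.sin_add_two_pi, Real.cos_add_two_pi])
    (fun θ => by simp only [hper θ, Real.sin_add_two_pi, Real.cos_add_two_pi])
    (fun θ => by
      have hd := (hden θ).ne'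
      have e1 := (h.hasDerivAt _ (hmem θ)).comp θ ((hder θ).mul (Real.hasDerivAt_sin θ))
      have e2 := (hder θ).mul (Real.hasDerivAt_cos θ)
      refine (e1.prodMk e2).congr_deriv ?_
      have hsc := Real.sin_sq_add_cos_sq θ
      have hen := h.energy _ (hmem θ)
      have hkd : k (r θ * Real.sin θ) =
        f.eval (ξ (r θ * Real.sin θ)) * ξ' (r θ * Real.sin θ) := rfl
      have hQ : polarField k ε θ (r θ) *
          (1 + ε * k (r θ * Real.sin θ) * (Real.sin θ * Real.cos θ)) =
          -(r θ * k (r θ * Real.sin θ) * Real.cos θ ^ 2) := div_mul_cancel₀ _ hd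
      refine Prod.ext ?_ ?_
      · simp only [lienard, Prod.smul_fst, smul_eq_mul]
        rw [div_mul_eq_mul_div, eq_div_iff hd]
        linear_combination ξ' (r θ * Real.sin θ) * ε * Real.sin θ * hQ
      · simp only [lienard, Prod.smul_snd, smul_eq_mul]
        rw [div_mul_eq_mul_div, eq_div_iff hd]
        linear_combination ε * Real.cos θ * hQ -
          ε * r θ * k (r θ * Real.sin θ) * Real.cos θ * hsc + hen - ε * r θ * Real.cos θ * hkd)
  refine ⟨γ, h1, h2, ?_, h3.symm⟩
  obtain ⟨t₁, ht₁⟩ : ((ξ (r 0 * Real.sin 0), r 0 * Real.cos 0) : ℝ × ℝ) ∈ range γ :=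
    h3 ▸ ⟨0, rfl⟩
  obtain ⟨t₂, ht₂⟩ : ((ξ (r Real.pi * Real.sin Real.pi), r Real.pi * Real.cos Real.pi) : ℝ × ℝ)
    ∈ range γ := h3 ▸ ⟨Real.pi, rfl⟩
  refine ⟨t₁, t₂, fun e => ?_⟩
  rw [ht₁, ht₂] at e
  have := congrArg Prod.snd e
  simp only [Real.cos_zero, Real.cos_pi] at this
  linarith [(hr 0).1, (hr Real.pi).1]

end EnergyChart

namespace EnergyChart

variable {f g : ℝ[X]} {ρ : ℝ} {ξ ξ' : ℝ → ℝ}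

/-- A solution staying in an annulus is described by a solution of the polar equation. -/
lemma exists_polar_solution (h : EnergyChart g ρ ξ ξ') {ε a b : ℝ} (ha : 0 < a) (hab : a ≤ b)
    (hb : b < ρ) (hε : ∀ s ∈ Icc (-b) b, |ε * damping f ξ ξ' s| ≤ 1 / 2) {s : ℝ → ℝ} {γ : ℝ → ℝ × ℝ}
    (hγ : ∀ t, HasDerivAt γ (lienard f g ε (γ t)) t) (hs : ∀ t, s t ∈ Ioo (-ρ) ρ)
    (hγs : ∀ t, ξ (s t) = (γ t).1) (ds : ∀ t, HasDerivAt s ((ξ' (s t))⁻¹ * (γ t).2) t)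
    (hann : ∀ t, s t ^ 2 + (γ t).2 ^ 2 ∈ Icc (a ^ 2) (b ^ 2)) :
    ∃ r : ℝ → ℝ, (∀ θ, r θ ∈ Icc a b) ∧
      (∀ θ, HasDerivAt r (ε * polarField (damping f ξ ξ') ε θ (r θ)) θ) ∧
      range γ = range fun θ => (ξ (r θ * Real.sin θ), r θ * Real.cos θ) := by
  set k := damping f ξ ξ' with hk
  set y : ℝ → ℝ := fun t => (γ t).2 with hy
  have hpos : ∀ t, 0 < s t ^ 2 + y t ^ 2 := fun t => (by positivity : 0 < a ^ 2).trans_le (hann t).1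
  have dy : ∀ t, HasDerivAt y (-(s t + ε * k (s t) * y t) * (ξ' (s t))⁻¹) t := fun t => by
    refine (hasFDerivAt_snd.comp_hasDerivAt t (hγ t)).congr_deriv ?_
    have h1 := h.energy _ (hs t)
    have h2 := (h.deriv_pos _ (hs t)).ne'
    simp only [lienard, ContinuousLinearMap.coe_snd']
    rw [eq_mul_inv_iff_mul_eq₀ h2, ← hγs]
    simp only [hk, damping, hy]
    linear_combination -h1
  have cs : Continuous s := continuous_iff_continuousAt.2 fun t => (ds t).continuousAt
  have cy : Continuous y := continuous_iff_continuousAt.2 fun t => (dy t).continuousAt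
  have cm : Continuous fun t => (ξ' (s t))⁻¹ :=
    (h.contDiffOn.continuousOn.comp_continuous cs hs).inv₀ fun t => (h.deriv_pos _ (hs t)).ne'
  have ck : Continuous fun t => k (s t) :=
    (h.contDiffOn_damping f).continuousOn.comp_continuous cs hs
  obtain ⟨θ, hθ⟩ := exists_polar_angle ds dy (cm.mul cy)
    ((cs.add ((continuous_const.mul ck).mul cy)).neg.mul cm) hpos
  set R : ℝ → ℝ := fun t => √(s t ^ 2 + y t ^ 2) with hR
  have Rpos : ∀ t, 0 < R t := fun t => Real.sqrt_pos.2 (hpos t)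
  have Rsq : ∀ t, R t ^ 2 = s t ^ 2 + y t ^ 2 := fun t => Real.sq_sqrt (hpos t).le
  have es : ∀ t, s t = R t * Real.sin (θ t) := fun t => (hθ t).2.1
  have ey : ∀ t, y t = R t * Real.cos (θ t) := fun t => (hθ t).2.2
  have hrad : ∀ t, R t ∈ Icc a b := fun t =>
    ⟨Real.le_sqrt_of_sq_le (hann t).1, Real.sqrt_le_iff.2 ⟨ha.le.trans hab, (hann t).2⟩⟩
  have hsb : ∀ t, s t ∈ Icc (-b) b := fun t => by
    rw [mem_Icc, ← abs_le, es, abs_mul, abs_of_pos (Rpos t)]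
    exact (mul_le_of_le_one_right (Rpos t).le (Real.abs_sin_le_one _)).trans (hrad t).2
  obtain ⟨M, hM⟩ := isCompact_Icc.exists_bound_of_continuousOn (h.contDiffOn.continuousOn.mono
    (show Icc (-b) b ⊆ Ioo (-ρ) ρ from Icc_subset_Ioo (by linarith) hb))
  have hMξ : ∀ t, ξ' (s t) ≤ M := fun t => (le_abs_self _).trans (hM _ (hsb t))
  have hM0 : 0 < M := (h.deriv_pos _ (hs 0)).trans_le (hMξ 0)
  have hden : ∀ t, 1 / 2 ≤ 1 + ε * k (s t) * (Real.sin (θ t) * Real.cos (θ t)) := by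
    intro t
    have e2 : |ε * k (s t) * (Real.sin (θ t) * Real.cos (θ t))| ≤ 1 / 2 * 1 := by
      rw [abs_mul]
      refine mul_le_mul (hε _ (hsb t)) ?_ (abs_nonneg _) (by norm_num)
      rw [abs_mul]
      exact mul_le_one₀ (Real.abs_sin_le_one _) (abs_nonneg _) (Real.abs_cos_le_one _)
    linarith [(abs_le.1 e2).1]
  have dθ : ∀ t, HasDerivAt θ ((ξ' (s t))⁻¹ *
      (1 + ε * k (s t) * (Real.sin (θ t) * Real.cos (θ t)))) t := fun t => by
    refine (hθ t).1.congr_deriv ?_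
    rw [div_eq_iff (hpos t).ne']
    change (ξ' (s t))⁻¹ * y t * y t - _ = _
    have := Rsq t
    have hsc := Real.sin_sq_add_cos_sq (θ t)
    linear_combination (ε * k (s t) * (ξ' (s t))⁻¹ * Real.sin (θ t) * Real.cos (θ t)) *
      this + ε * k (s t) * (ξ' (s t))⁻¹ * (y t * es t + R t * Real.sin (θ t) * ey t)
  have dR : ∀ t, HasDerivAt R (-((ξ' (s t))⁻¹ * (ε * (R t * k (s t) * Real.cos (θ t) ^ 2)))) t :=
    fun t => by
    refine ((((ds t).pow 2).add ((dy t).pow 2)).sqrt (hpos t).ne').congr_deriv ?_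
    have h0 := (Rpos t).ne'
    rw [div_eq_iff (by exact mul_ne_zero two_ne_zero h0)]
    simp only [Pi.add_apply, Pi.pow_apply]
    change _ = _ * (2 * R t)
    change 2 * s t ^ 1 * ((ξ' (s t))⁻¹ * y t) + 2 * y t ^ 1 * _ = _
    linear_combination -2 * ε * k (s t) * (ξ' (s t))⁻¹ * (y t + R t * Real.cos (θ t)) * ey t
  obtain ⟨τ, hl, hr, hτ⟩ := exists_inverse_of_deriv_ge (T := θ) (c := M⁻¹ * (1 / 2))
    (by positivity) dθ fun t => mul_le_mul
      (inv_anti₀ (h.deriv_pos _ (hs t)) (hMξ t)) (hden t) (by norm_num)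
      (inv_pos.2 (h.deriv_pos _ (hs t))).le
  refine ⟨R ∘ τ, fun u => hrad _, fun u => ?_, ?_⟩
  · refine ((dR (τ u)).comp u (hτ u)).congr_deriv ?_
    have hu : θ (τ u) = u := hr u
    have h1 := (h.deriv_pos _ (hs (τ u))).ne'
    have h2 : 1 + ε * k (s (τ u)) * (Real.sin u * Real.cos u) ≠ 0 := by
      have := hden (τ u); rw [hu] at this; linarith
    have h3 : R (τ u) * Real.sin u = s (τ u) := by rw [es (τ u), hu]
    simp only [polarField, Function.comp_apply, hu, h3]
    field_simp
  · rw [← hr.surjective.range_comp fun u => (ξ ((R ∘ τ) u * Real.sin u), (R ∘ τ) u * Real.cos u)]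
    congr 1
    funext t
    simp only [Function.comp_apply, hl t, ← es, ← ey, hγs, hy]

/-- A simple zero of the Melnikov function of an energy chart yields a limit cycle. -/
theorem exists_isLimitCycle (h : EnergyChart g ρ ξ ξ') {r₀ : ℝ} {V : Set ℝ}
    (hr₀ : r₀ ∈ Ioo 0 ρ) (hV : V ∈ 𝓝 r₀) (h0 : melnikov (damping f ξ ξ') r₀ = 0)
    (h1 : deriv (melnikov (damping f ξ ξ')) r₀ ≠ 0) :
    ∃ ε₀ > 0, ∀ ε, 0 < ε → ε ≤ ε₀ →
      ∃ Γ, IsLimitCycle (lienard f g ε) Γ ∧ Γ ⊆ energyAnnulus ξ V := by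
  obtain ⟨κ₁, hκ₁, hball⟩ := Metric.mem_nhds_iff.1 hV
  obtain ⟨κ, κpos, κκ₁, κr₀, κρ, ε₀, hε₀, H⟩ :=
    exists_unique_periodic_polarField (h.contDiffOn_damping f) hr₀ hκ₁ h0 h1
  refine ⟨ε₀, hε₀, fun ε he hle => ?_⟩
  obtain ⟨hsmall, ⟨r, rper, rmem, rder⟩, huniq⟩ := H ε he hle
  have ha : 0 < r₀ - κ := by linarith
  refine ⟨_, ⟨h.isPeriodicOrbit ha κρ hsmall rper rmem rder, ?_⟩, ?_⟩
  · obtain ⟨hopen, S, hS⟩ := h.exists_inverse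
    refine ⟨((ξ '' Ioo (-ρ) ρ) ×ˢ univ) ∩
      (fun p : ℝ × ℝ => S p.1 ^ 2 + p.2 ^ 2) ⁻¹' Ioo ((r₀ - κ) ^ 2) ((r₀ + κ) ^ 2), ?_, ?_, ?_⟩
    · refine ContinuousOn.isOpen_inter_preimage ?_ (hopen.prod isOpen_univ) isOpen_Ioo
      have : ContinuousOn S (ξ '' Ioo (-ρ) ρ) := by
        rintro _ ⟨s, hs, rfl⟩
        exact (hS s hs).2.continuousAt.continuousWithinAt
      exact ((this.comp continuousOn_fst fun p hp => hp.1).pow 2).add (continuousOn_snd.pow 2)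
    · rintro _ ⟨θ, rfl⟩
      have hmem : r θ * Real.sin θ ∈ Ioo (-ρ) ρ :=
        mul_sin_mem_Ioo ⟨by linarith [(rmem θ).1], by linarith [(rmem θ).2]⟩ θ
      refine ⟨⟨mem_image_of_mem _ hmem, mem_univ _⟩, ?_⟩
      have e : (r θ * Real.sin θ) ^ 2 + (r θ * Real.cos θ) ^ 2 = r θ ^ 2 := by
        linear_combination r θ ^ 2 * Real.sin_sq_add_cos_sq θ
      simp only [mem_preimage, (hS _ hmem).1, e]
      have := rmem θ
      exact ⟨pow_lt_pow_left₀ this.1 ha.le two_ne_zero,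
        pow_lt_pow_left₀ this.2 (ha.le.trans this.1.le) two_ne_zero⟩
    · rintro Γ' ⟨γ, hγ, -, -, rfl⟩ hsub
      have hγU := fun t => hsub (mem_range_self t)
      have hinv : ∀ t, S (γ t).1 ∈ Ioo (-ρ) ρ ∧ ξ (S (γ t).1) = (γ t).1 := fun t => by
        obtain ⟨s, hs, he⟩ := (hγU t).1.1
        rw [← he, (hS s hs).1]
        exact ⟨hs, rfl⟩
      obtain ⟨r', r'mem, r'der, hr'⟩ := h.exists_polar_solution (s := fun t => S (γ t).1) ha
        (by linarith : r₀ - κ ≤ r₀ + κ) κρ hsmall hγ (fun t => (hinv t).1) (fun t => (hinv t).2)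
        (fun t => by
          have h1 := (hS _ (hinv t).1).2
          rw [(hinv t).2] at h1
          have h2 : HasDerivAt (fun t => (γ t).1) (γ t).2 t :=
            (hasFDerivAt_fst.comp_hasDerivAt t (hγ t)).congr_deriv rfl
          exact h1.comp t h2)
        (fun t => Ioo_subset_Icc_self (hγU t).2)
      rw [hr', huniq r' r r'mem (fun θ => Ioo_subset_Icc_self (rmem θ)) r'der rder]
  · rintro _ ⟨θ, rfl⟩
    refine ⟨r θ, hball ?_, θ, rfl⟩
    rw [Metric.mem_ball, Real.dist_eq, abs_lt]
    exact ⟨by linarith [(rmem θ).1], by linarith [(rmem θ).2]⟩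

end EnergyChart

/-- A simple zero persists, as a simple zero, under small perturbations. -/
lemma eventually_exists_simple_zero_add_mul {A B : ℝ → ℝ} {z : ℝ} {V : Set ℝ}
    (hA : ContDiffAt ℝ 1 A z) (hB : ContDiffAt ℝ 1 B z) (h0 : A z = 0) (h1 : deriv A z ≠ 0)
    (hV : V ∈ 𝓝 z) :
    ∀ᶠ t in 𝓝 (0 : ℝ), ∃ x ∈ V, A x + t * B x = 0 ∧ deriv (fun x => A x + t * B x) x ≠ 0 := by
  have sA : HasStrictDerivAt A (deriv A z) z := hA.hasStrictDerivAt one_ne_zero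
  have sB : HasStrictDerivAt B (deriv B z) z := hB.hasStrictDerivAt one_ne_zero
  have hfst : HasStrictFDerivAt (Prod.fst : ℝ × ℝ → ℝ) (ContinuousLinearMap.fst ℝ ℝ ℝ) (0, z) :=
    hasStrictFDerivAt_fst
  have hsnd : HasStrictFDerivAt (Prod.snd : ℝ × ℝ → ℝ) (ContinuousLinearMap.snd ℝ ℝ ℝ) (0, z) :=
    hasStrictFDerivAt_snd
  have hΦ := hfst.prodMk ((sA.comp_hasStrictFDerivAt (0, z) hsnd).add
    (hfst.mul (sB.comp_hasStrictFDerivAt (0, z) hsnd)))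
  have hmap := hΦ.map_nhds_eq_of_surj (by
    rw [LinearMap.range_eq_top]
    rintro ⟨u, v⟩
    refine ⟨(u, (v - B z * u) / deriv A z), ?_⟩
    simp
    field_simp
    ring)
  have hcont : ∀ {F : ℝ → ℝ}, ContDiffAt ℝ 1 F z → ContinuousAt (fun p : ℝ × ℝ => deriv F p.2)
      (0, z) := fun {F} hF => ContinuousAt.comp' (f := Prod.snd) (g := deriv F)
        ((hF.continuousAt_fderiv one_ne_zero).clm_apply continuousAt_const) continuousAt_snd
  have hdiff : ∀ {F : ℝ → ℝ}, ContDiffAt ℝ 1 F z → ∀ᶠ p in 𝓝 ((0 : ℝ), z),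
      DifferentiableAt ℝ F p.2 := fun {F} hF =>
    (continuousAt_snd (p := ((0 : ℝ), z))).eventually ((hF.eventually (by simp)).mono fun x hx =>
      hx.differentiableAt one_ne_zero)
  have hW : {p : ℝ × ℝ | p.2 ∈ V ∧ deriv (fun x => A x + p.1 * B x) p.2 ≠ 0} ∈
      𝓝 ((0 : ℝ), z) := by
    have hne := ((hcont hA).add (continuousAt_fst.mul (hcont hB))).eventually_ne
      (show deriv A z + 0 * deriv B z ≠ 0 by simpa)
    filter_upwards [hne, hdiff hA, hdiff hB, continuousAt_snd.preimage_mem_nhds hV]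
      with p hp hpA hpB hpV
    refine ⟨hpV, ?_⟩
    rwa [deriv_fun_add hpA (hpB.const_mul _), deriv_const_mul _ hpB]
  have him := image_mem_map (m := fun p : ℝ × ℝ => (p.1, A p.2 + p.1 * B p.2)) hW
  have hev := hmap.ge him
  simp only [Pi.add_apply, Pi.mul_apply, Function.comp_apply, h0, zero_mul, add_zero] at hev
  have hslice : ContinuousAt (fun t : ℝ => (t, (0 : ℝ))) 0 := by fun_prop
  filter_upwards [hslice.preimage_mem_nhds hev] with t ⟨p, ⟨hpV, hp⟩, he⟩
  obtain ⟨rfl, hz⟩ := Prod.mk.inj he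
  exact ⟨p.2, hpV, hz, hp⟩

/-- Switching on a term of lower order creates a simple zero near the origin. -/
lemma eventually_simple_zero_sq_mul_add {E B : ℝ → ℝ} (hE : ContDiffAt ℝ 1 E 0)
    (hB : ContDiffAt ℝ 1 B 0) (hE0 : E 0 ≠ 0) (hB0 : B 0 ≠ 0) :
    Tendsto (fun r => -(r ^ 2 * E r / B r)) (𝓝[>] 0) (𝓝 0) ∧
    ∀ᶠ r in 𝓝[>] (0 : ℝ), -(r ^ 2 * E r / B r) ≠ 0 ∧
      r ^ 2 * E r + -(r ^ 2 * E r / B r) * B r = 0 ∧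
      deriv (fun x => x ^ 2 * E x + -(r ^ 2 * E r / B r) * B x) r ≠ 0 := by
  have cderiv : ∀ {F : ℝ → ℝ}, ContDiffAt ℝ 1 F 0 → ContinuousAt (deriv F) 0 := fun {F} hF =>
    (hF.continuousAt_fderiv one_ne_zero).clm_apply continuousAt_const
  have hdiff : ∀ {F : ℝ → ℝ}, ContDiffAt ℝ 1 F 0 → ∀ᶠ x in 𝓝 (0 : ℝ), DifferentiableAt ℝ F x :=
    fun {F} hF => (hF.eventually (by simp)).mono fun x hx => hx.differentiableAt one_ne_zero
  constructor
  · have : ContinuousAt (fun r => -(r ^ 2 * E r / B r)) 0 :=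
      (((continuousAt_id.pow 2).mul hE.continuousAt).div hB.continuousAt hB0).neg
    have := this.tendsto.mono_left (nhdsWithin_le_nhds (s := Ioi 0))
    simpa using this
  · have hne : ∀ᶠ r in 𝓝 (0 : ℝ), 2 * E r + r * deriv E r - r * E r / B r * deriv B r ≠ 0 := by
      refine ContinuousAt.eventually_ne (((continuousAt_const.mul hE.continuousAt).add
        (continuousAt_id.mul (cderiv hE))).sub (((continuousAt_id.mul hE.continuousAt).div
          hB.continuousAt hB0).mul (cderiv hB))) ?_
      simpa using hE0
    filter_upwards [nhdsWithin_le_nhds hne, nhdsWithin_le_nhds (hdiff hE),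
      nhdsWithin_le_nhds (hdiff hB), nhdsWithin_le_nhds (hE.continuousAt.eventually_ne hE0),
      nhdsWithin_le_nhds (hB.continuousAt.eventually_ne hB0), self_mem_nhdsWithin]
      with r hr hrE hrB hrE0 hrB0 hr0
    have hr0' : r ≠ 0 := (mem_Ioi.1 hr0).ne'
    refine ⟨by simp [hr0', hrE0, hrB0], by field_simp; ring, ?_⟩
    have hd : HasDerivAt (fun x => x ^ 2 * E x + -(r ^ 2 * E r / B r) * B x)
        (r * (2 * E r + r * deriv E r - r * E r / B r * deriv B r)) r := by
      refine (((hasDerivAt_pow 2 r).mul hrE.hasDerivAt).add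
        (hrB.hasDerivAt.const_mul _)).congr_deriv ?_
      field_simp
      ring
    rw [hd.deriv]
    exact mul_ne_zero hr0' hr

/-- A combination of `n + 1` functions of distinct even orders at the origin may have `n`
simple positive zeros. -/
theorem exists_sum_pow_mul_simple_zeros {ρ : ℝ} (hρ : 0 < ρ) (n : ℕ) (B : ℕ → ℝ → ℝ)
    (hB : ∀ l, ContDiffOn ℝ 1 (B l) (Ioo (-ρ) ρ)) (hB0 : ∀ l, B l 0 ≠ 0) :
    ∃ δ : ℕ → ℝ, δ 0 ≠ 0 ∧ ∃ Z : Finset ℝ, Z.card = n ∧ ∀ z ∈ Z, z ∈ Ioo 0 ρ ∧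
      ∑ l ∈ Finset.range (n + 1), δ l * (z ^ (2 * l) * B l z) = 0 ∧
      deriv (fun r => ∑ l ∈ Finset.range (n + 1), δ l * (r ^ (2 * l) * B l r)) z ≠ 0 := by
  induction n generalizing B with
  | zero => exact ⟨fun _ => 1, one_ne_zero, ∅, rfl, by simp⟩
  | succ n ih =>
    obtain ⟨δ, hδ, Z, hZ, H⟩ := ih (fun l => B (l + 1)) (fun l => hB _) (fun l => hB0 _)
    set E : ℝ → ℝ := fun r => ∑ l ∈ Finset.range (n + 1), δ l * (r ^ (2 * l) * B (l + 1) r)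
      with hEdef
    have hE : ContDiffOn ℝ 1 E (Ioo (-ρ) ρ) := ContDiffOn.sum fun l _ =>
      contDiffOn_const.mul ((contDiffOn_id.pow _).mul (hB _))
    have hat : ∀ {F : ℝ → ℝ}, ContDiffOn ℝ 1 F (Ioo (-ρ) ρ) → ∀ x ∈ Ioo (-ρ) ρ,
        ContDiffAt ℝ 1 F x := fun hF x hx => hF.contDiffAt (isOpen_Ioo.mem_nhds hx)
    have h0mem : (0 : ℝ) ∈ Ioo (-ρ) ρ := ⟨by linarith, hρ⟩
    have hE0 : E 0 ≠ 0 := by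
      rw [hEdef]
      simp only [Finset.sum_range_succ']
      simpa using ⟨hδ, hB0 1⟩
    obtain ⟨ht, hev⟩ := eventually_simple_zero_sq_mul_add (hat hE 0 h0mem) (hat (hB 0) 0 h0mem)
      hE0 (hB0 0)
    obtain ⟨U, hU, hdisj⟩ := (Set.toFinite (insert (0 : ℝ) (Z : Set ℝ))).t2_separation
    have h0Z : (0 : ℝ) ∉ Z := fun h => (H 0 h).1.1.false
    have hpert : ∀ᶠ t in 𝓝 (0 : ℝ), ∀ z ∈ Z, ∃ x ∈ U z ∩ Ioo 0 ρ,
        x ^ 2 * E x + t * B 0 x = 0 ∧ deriv (fun x => x ^ 2 * E x + t * B 0 x) x ≠ 0 := by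
      rw [Filter.eventually_all_finset]
      intro z hz
      obtain ⟨hzρ, hz0, hz1⟩ := H z hz
      have hzρ' : z ∈ Ioo (-ρ) ρ := ⟨by linarith [hzρ.1], hzρ.2⟩
      have hEz := hat hE z hzρ'
      refine eventually_exists_simple_zero_add_mul ((contDiffAt_id.pow 2).mul hEz)
        (hat (hB 0) z hzρ') ?_ ?_ (inter_mem ((hU z).2.mem_nhds (hU z).1)
          (isOpen_Ioo.mem_nhds hzρ))
      · simp [E, hz0]
      · have hd : HasDerivAt (fun x => x ^ 2 * E x) (z ^ 2 * deriv E z) z := by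
          refine ((hasDerivAt_pow 2 z).mul
            (hEz.differentiableAt one_ne_zero).hasDerivAt).congr_deriv ?_
          have : E z = 0 := hz0
          rw [this]; ring
        change deriv (fun x => x ^ 2 * E x) z ≠ 0
        rw [hd.deriv]
        exact mul_ne_zero (pow_ne_zero 2 hzρ.1.ne') hz1
    have hU0 : ∀ᶠ r in 𝓝[>] (0 : ℝ), r ∈ U 0 :=
      nhdsWithin_le_nhds ((hU 0).2.mem_nhds (hU 0).1)
    have hρ0 : ∀ᶠ r in 𝓝[>] (0 : ℝ), r ∈ Ioo 0 ρ := Ioo_mem_nhdsGT hρ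
    obtain ⟨r, ⟨hr0, hr1, hr2⟩, hrZ, hrU, hrρ⟩ :=
      (hev.and ((ht.eventually hpert).and (hU0.and hρ0))).exists
    set t := -(r ^ 2 * E r / B 0 r)
    choose! x hx hx0 hx1 using hrZ
    have hsum : ∀ y, ∑ l ∈ Finset.range (n + 1 + 1), (Nat.casesOn l t δ : ℝ) * (y ^ (2 * l) * B l y)
        = y ^ 2 * E y + t * B 0 y := fun y => by
      rw [Finset.sum_range_succ', hEdef, Finset.mul_sum]
      simp only [mul_zero, pow_zero, one_mul]
      congr 1
      exact Finset.sum_congr rfl fun l _ => by ring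
    have hinj : InjOn x Z := fun z hz z' hz' he => by
      by_contra hne
      exact (hdisj (mem_insert_of_mem _ hz) (mem_insert_of_mem _ hz') hne).ne_of_mem
        (hx z hz).1 (hx z' hz').1 he
    have hnot : r ∉ Z.image x := fun hmem => by
      obtain ⟨z, hz, he⟩ := Finset.mem_image.1 hmem
      exact (hdisj (mem_insert _ _) (mem_insert_of_mem _ hz)
        (ne_of_mem_of_not_mem hz h0Z).symm).ne_of_mem hrU (hx z hz).1 he.symm
    refine ⟨fun l => Nat.casesOn l t δ, hr0, insert r (Z.image x), ?_, ?_⟩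
    · rw [Finset.card_insert_of_notMem hnot, Finset.card_image_of_injOn hinj, hZ]
    · simp only [hsum]
      intro z hz
      obtain rfl | hz := Finset.mem_insert.1 hz
      · exact ⟨hrρ, hr1, hr2⟩
      · obtain ⟨z, hz', rfl⟩ := Finset.mem_image.1 hz
        exact ⟨(hx z hz').2, hx0 z hz', hx1 z hz'⟩

lemma melnikov_congr {k k' : ℝ → ℝ} {ρ r : ℝ} (h : ∀ s ∈ Ioo (-ρ) ρ, k s = k' s)
    (hr : r ∈ Ioo (-ρ) ρ) : melnikov k r = melnikov k' r := by
  unfold melnikov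
  congr 1
  funext θ
  rw [h _ (mul_sin_mem_Ioo hr θ)]

lemma melnikov_comp_neg (k : ℝ → ℝ) (r : ℝ) : melnikov (fun s => k (-s)) r = melnikov k r := by
  unfold melnikov
  have hper : Function.Periodic (fun θ => Real.cos θ ^ 2 * k (r * Real.sin θ)) (2 * Real.pi) :=
    fun θ => by simp
  have h1 := intervalIntegral.integral_comp_neg (a := 0) (b := 2 * Real.pi)
    (fun θ => Real.cos θ ^ 2 * k (r * Real.sin θ))
  have h2 := hper.intervalIntegral_add_eq (-(2 * Real.pi)) 0
  rw [neg_add_cancel, zero_add] at h2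
  rw [neg_zero, h2] at h1
  rw [← h1]
  simp

lemma melnikov_const_mul (c : ℝ) (k : ℝ → ℝ) (r : ℝ) :
    melnikov (fun s => c * k s) r = c * melnikov k r := by
  unfold melnikov
  rw [← intervalIntegral.integral_const_mul]
  congr 1
  funext θ
  ring

lemma melnikov_neg (k : ℝ → ℝ) (r : ℝ) : melnikov (fun s => -k s) r = -melnikov k r := by
  simpa using melnikov_const_mul (-1) k r

lemma melnikov_eq_zero_of_odd {k : ℝ → ℝ} {ρ r : ℝ} (h : ∀ s ∈ Ioo (-ρ) ρ, k (-s) = -k s)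
    (hr : r ∈ Ioo (-ρ) ρ) : melnikov k r = 0 := by
  have h1 := melnikov_congr (k' := fun s => -k (-s)) (fun s hs => by rw [h s hs, neg_neg]) hr
  rw [melnikov_neg (fun s => k (-s)), melnikov_comp_neg] at h1
  linarith

lemma melnikov_add {k k' : ℝ → ℝ} {ρ r : ℝ} (hk : ContinuousOn k (Ioo (-ρ) ρ))
    (hk' : ContinuousOn k' (Ioo (-ρ) ρ)) (hr : r ∈ Ioo (-ρ) ρ) :
    melnikov (fun s => k s + k' s) r = melnikov k r + melnikov k' r := by
  unfold melnikov
  have hcont : ∀ {j : ℝ → ℝ}, ContinuousOn j (Ioo (-ρ) ρ) →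
      Continuous fun θ => Real.cos θ ^ 2 * j (r * Real.sin θ) := fun hj =>
    (Real.continuous_cos.pow 2).mul (hj.comp_continuous (by fun_prop) (mul_sin_mem_Ioo hr))
  rw [← intervalIntegral.integral_add ((hcont hk).intervalIntegrable _ _)
    ((hcont hk').intervalIntegrable _ _)]
  congr 1
  funext θ
  ring

/-- Inside `D`, a well of the potential with derivative `g` carries a simple zero of the Melnikov
function of the damping `f`; the coordinate of the well takes values in `I`. -/
def HasSimpleCycleIn (f g : ℝ[X]) (I : Set ℝ) (D : Set (ℝ × ℝ)) : Prop :=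
  ∃ (ρ : ℝ) (ξ ξ' : ℝ → ℝ) (V : Set ℝ) (r : ℝ), EnergyChart g ρ ξ ξ' ∧
    (∀ s ∈ Ioo (-ρ) ρ, ξ s ∈ I) ∧ IsOpen V ∧ V ⊆ Ioo 0 ρ ∧ r ∈ V ∧
    melnikov (damping f ξ ξ') r = 0 ∧ deriv (melnikov (damping f ξ ξ')) r ≠ 0 ∧
    energyAnnulus ξ V ⊆ D

namespace HasSimpleCycleIn

variable {f g : ℝ[X]} {I : Set ℝ} {D : Set (ℝ × ℝ)}

lemma mono (h : HasSimpleCycleIn f g I D) {I' : Set ℝ} {D' : Set (ℝ × ℝ)} (hI : I ⊆ I')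
    (hD : D ⊆ D') : HasSimpleCycleIn f g I' D' := by
  obtain ⟨ρ, ξ, ξ', V, r, hc, hξ, hV, hVρ, hr, h0, h1, hVD⟩ := h
  exact ⟨ρ, ξ, ξ', V, r, hc, fun s hs => hI (hξ s hs), hV, hVρ, hr, h0, h1, hVD.trans hD⟩

/-- Reflecting the position coordinate. -/
lemma reflect (h : HasSimpleCycleIn f g I D) :
    HasSimpleCycleIn (-f.comp (-X)) (-g.comp (-X)) {x | -x ∈ I} {p | (-p.1, p.2) ∈ D} := by
  obtain ⟨ρ, ξ, ξ', V, r, hc, hξ, hV, hVρ, hr, h0, h1, hVD⟩ := h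
  have hneg : ∀ s ∈ Ioo (-ρ) ρ, -s ∈ Ioo (-ρ) ρ := fun s hs =>
    ⟨by linarith [hs.2], by linarith [hs.1]⟩
  have hm : melnikov (damping (-f.comp (-X)) (fun s => -ξ (-s)) fun s => ξ' (-s)) =
      fun r => -melnikov (damping f ξ ξ') r := by
    funext r
    rw [← melnikov_comp_neg (damping f ξ ξ'), ← melnikov_neg]
    congr 1
    funext s
    simp [damping]
  refine ⟨ρ, fun s => -ξ (-s), fun s => ξ' (-s), V, r, ⟨hc.pos, fun s hs => ?_, ?_, fun s hs =>
    hc.deriv_pos _ (hneg s hs), fun s hs => ?_⟩, fun s hs => ?_, hV, hVρ, hr, ?_, ?_, ?_⟩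
  · have := (hc.hasDerivAt _ (hneg s hs)).comp s (hasDerivAt_neg s)
    exact this.neg.congr_deriv (by ring)
  · exact hc.contDiffOn.comp contDiff_neg.contDiffOn hneg
  · have := hc.energy _ (hneg s hs)
    simp only [eval_neg, eval_comp, eval_X, neg_neg]
    linarith
  · simpa using hξ _ (hneg s hs)
  · simp [hm, h0]
  · rw [hm]
    simpa [deriv.fun_neg] using h1
  · rintro _ ⟨r, hr, θ, rfl⟩
    refine hVD ⟨r, hr, -θ, ?_⟩
    simp

/-- Unfolding the position coordinate along `x ↦ x ^ 2 - c`. -/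
lemma unfold_sq (h : HasSimpleCycleIn f g I D) {c : ℝ} (hI : ∀ x ∈ I, 1 < x + c) :
    HasSimpleCycleIn (f.comp (X ^ 2 - C c) * (2 * X)) (g.comp (X ^ 2 - C c) * (2 * X))
      {x | 1 < x ∧ x ^ 2 - c ∈ I} {p | 1 < p.1 ∧ (p.1 ^ 2 - c, p.2) ∈ D} := by
  obtain ⟨ρ, ξ, ξ', V, r, hc, hξ, hV, hVρ, hr, h0, h1, hVD⟩ := h
  have h1c : ∀ s ∈ Ioo (-ρ) ρ, 1 < ξ s + c := fun s hs => hI _ (hξ s hs)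
  have hsq : ∀ s ∈ Ioo (-ρ) ρ, √(ξ s + c) ^ 2 = ξ s + c := fun s hs =>
    Real.sq_sqrt (by linarith [h1c s hs])
  have hone : ∀ s ∈ Ioo (-ρ) ρ, 1 < √(ξ s + c) := fun s hs => by
    rw [Real.lt_sqrt zero_le_one]; linarith [h1c s hs]
  have hunf : ∀ (j : ℝ[X]), ∀ s ∈ Ioo (-ρ) ρ, (j.comp (X ^ 2 - C c) * (2 * X)).eval √(ξ s + c) *
      (ξ' s / (2 * √(ξ s + c))) = j.eval (ξ s) * ξ' s := fun j s hs => by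
    have := (zero_lt_one.trans (hone s hs)).ne'
    simp only [eval_mul, eval_comp, eval_sub, eval_pow, eval_X, eval_C, eval_ofNat, hsq s hs,
      add_sub_cancel_right]
    field_simp
  have hm : ∀ r ∈ Ioo (-ρ) ρ, melnikov (damping (f.comp (X ^ 2 - C c) * (2 * X))
      (fun s => √(ξ s + c)) fun s => ξ' s / (2 * √(ξ s + c))) r = melnikov (damping f ξ ξ') r :=
    fun r hr => melnikov_congr (fun s hs => hunf f s hs) hr
  have hrρ : r ∈ Ioo (-ρ) ρ := ⟨by linarith [(hVρ hr).1, (hVρ hr).2], (hVρ hr).2⟩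
  refine ⟨ρ, fun s => √(ξ s + c), fun s => ξ' s / (2 * √(ξ s + c)), V, r, ⟨hc.pos, fun s hs => ?_,
    ?_, fun s hs => ?_, fun s hs => ?_⟩, fun s hs => ⟨hone s hs, ?_⟩, hV, hVρ, hr, ?_, ?_, ?_⟩
  · exact ((hc.hasDerivAt s hs).add_const c).sqrt (by linarith [h1c s hs])
  · refine hc.contDiffOn.div (contDiffOn_const.mul ((hc.contDiffOn_one.add
      contDiffOn_const).sqrt fun s hs => ?_)) fun s hs => ?_
    · linarith [h1c s hs]
    · linarith [hone s hs]
  · exact div_pos (hc.deriv_pos s hs) (by linarith [hone s hs])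
  · rw [hunf g s hs, hc.energy s hs]
  · simpa [hsq s hs] using hξ s hs
  · rw [hm r hrρ, h0]
  · rwa [Filter.EventuallyEq.deriv_eq
      (Filter.eventuallyEq_of_mem (isOpen_Ioo.mem_nhds hrρ) hm)]
  · rintro _ ⟨r, hr, θ, rfl⟩
    have hs : r * Real.sin θ ∈ Ioo (-ρ) ρ :=
      mul_sin_mem_Ioo ⟨by linarith [(hVρ hr).1, (hVρ hr).2], (hVρ hr).2⟩ θ
    refine ⟨hone _ hs, hVD ⟨r, hr, θ, ?_⟩⟩
    simp [hsq _ hs]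

/-- Simple cycles persist under small changes of the damping. -/
lemma eventually_add_mul (h : HasSimpleCycleIn f g I D) (f₁ : ℝ[X]) :
    ∀ᶠ t in 𝓝 (0 : ℝ), HasSimpleCycleIn (f + C t * f₁) g I D := by
  obtain ⟨ρ, ξ, ξ', V, r, hc, hξ, hV, hVρ, hr, h0, h1, hVD⟩ := h
  have hmem : ∀ r ∈ V, r ∈ Ioo (-ρ) ρ := fun r hr =>
    ⟨by linarith [(hVρ hr).1, (hVρ hr).2], (hVρ hr).2⟩
  have hat : ∀ f : ℝ[X], ContDiffAt ℝ 1 (melnikov (damping f ξ ξ')) r := fun f =>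
    (contDiffOn_melnikov (hc.contDiffOn_damping f)).contDiffAt (isOpen_Ioo.mem_nhds (hmem r hr))
  filter_upwards [eventually_exists_simple_zero_add_mul (hat f) (hat f₁) h0 h1 (hV.mem_nhds hr)]
    with t ⟨x, hx, hx0, hx1⟩
  have hm : ∀ r ∈ Ioo (-ρ) ρ, melnikov (damping (f + C t * f₁) ξ ξ') r =
      melnikov (damping f ξ ξ') r + t * melnikov (damping f₁ ξ ξ') r := fun r hr => by
    rw [← melnikov_const_mul, ← melnikov_add (k' := fun s => t * damping f₁ ξ ξ' s)
      (hc.contDiffOn_damping f).continuousOn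
      (continuousOn_const.mul (hc.contDiffOn_damping f₁).continuousOn) hr]
    congr 1
    funext s
    simp only [damping, eval_add, eval_mul, eval_C]
    ring
  refine ⟨ρ, ξ, ξ', V, x, hc, hξ, hV, hVρ, hx, ?_, ?_, hVD⟩
  · rw [hm x (hmem x hx), hx0]
  · rwa [Filter.EventuallyEq.deriv_eq
      (Filter.eventuallyEq_of_mem (isOpen_Ioo.mem_nhds (hmem x hx)) hm)]

end HasSimpleCycleIn

/-- A nondegenerate well of an even potential has an odd energy coordinate. -/
lemma exists_odd_energyChart {P : ℝ[X]} (heven : ∀ x, P.eval (-x) = P.eval x)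
    (h0 : 0 < P.eval 0) : ∃ ρ ξ ξ', EnergyChart (derivative (X ^ 2 * P)) ρ ξ ξ' ∧
      (∀ s ∈ Ioo (-ρ) ρ, ξ s ∈ Ioo (-1) 1 ∧ ξ (-s) = -ξ s ∧ ξ' (-s) = ξ' s) ∧
      ∀ s ∈ Ioo (-ρ) ρ, 0 < P.eval (ξ s) ∧ ξ s ^ 2 * (2 * P.eval (ξ s)) = s ^ 2 := by
  set S : ℝ → ℝ := fun x => x * √(2 * P.eval x) with hS
  have hP : Continuous fun x => P.eval x := P.continuous
  have hPc : ContDiff ℝ 2 fun x => P.eval x := P.contDiff_aeval 2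
  have hodd : ∀ x, S (-x) = -S x := fun x => by simp [hS, heven]
  have hSC : ∀ {x}, 0 < P.eval x → ContDiffAt ℝ 2 S x := fun {x} hx =>
    contDiffAt_id.mul ((contDiffAt_const.mul hPc.contDiffAt).sqrt (by positivity))
  have hSd : ∀ {x}, 0 < P.eval x → HasDerivAt S (deriv S x) x := fun hx =>
    ((hSC hx).differentiableAt two_ne_zero).hasDerivAt
  have hsq : ∀ {x}, 0 < P.eval x → S x ^ 2 = x ^ 2 * (2 * P.eval x) := fun hx => by
    rw [hS, mul_pow, Real.sq_sqrt (by positivity)]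
  have hSS : ∀ {x}, 0 < P.eval x → S x * deriv S x = (derivative (X ^ 2 * P)).eval x := by
    intro x hx
    have h1 : HasDerivAt (fun x => S x ^ 2) (2 * (S x * deriv S x)) x :=
      ((hSd hx).pow 2).congr_deriv (by ring)
    have h2 : HasDerivAt (fun x => 2 * (X ^ 2 * P).eval x)
        (2 * (derivative (X ^ 2 * P)).eval x) x :=
      ((X ^ 2 * P).hasDerivAt x).const_mul 2
    have h3 : (fun x => S x ^ 2) =ᶠ[𝓝 x] fun x => 2 * (X ^ 2 * P).eval x := by
      filter_upwards [hP.continuousAt.eventually (lt_mem_nhds hx)] with y hy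
      rw [hsq hy]
      simp only [eval_mul, eval_pow, eval_X]
      ring
    have := (h2.congr_of_eventuallyEq h3).unique h1
    linarith
  have hd0 : deriv S 0 = √(2 * P.eval 0) := by
    have h1 : HasDerivAt (fun x => √(2 * P.eval x)) _ 0 :=
      ((P.hasDerivAt 0).const_mul 2).sqrt (by positivity)
    have h2 : HasDerivAt S _ 0 := (hasDerivAt_id (0 : ℝ)).mul h1
    rw [h2.deriv]
    simp
  have hd0' : 0 < deriv S 0 := by rw [hd0]; positivity
  have hS0 : S 0 = 0 := by simp [hS]
  have hf := (hSd h0).hasFDerivAt_equiv hd0'.ne'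
  set ξ := (hSC h0).localInverse hf two_ne_zero with hξ
  have hstrict := (hSC h0).hasStrictFDerivAt' hf two_ne_zero
  have hξ0 : ξ 0 = 0 := by
    have := (hSC h0).localInverse_apply_image hf two_ne_zero
    rwa [hS0] at this
  have hξC : ContDiffAt ℝ 2 ξ 0 := by
    have := (hSC h0).to_localInverse hf two_ne_zero
    rwa [hS0] at this
  have hright : ∀ᶠ s in 𝓝 0, S (ξ s) = s := by
    have := hstrict.eventually_right_inverse
    rwa [hS0] at this
  have hleft : ∀ᶠ x in 𝓝 0, ξ (S x) = x := hstrict.eventually_left_inverse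
  have hlim : Tendsto ξ (𝓝 0) (𝓝 0) := by simpa [hξ0] using hξC.continuousAt.tendsto
  have hlim' : Tendsto (fun s => -ξ s) (𝓝 0) (𝓝 0) := by simpa using hlim.neg
  have hdS : ∀ᶠ x in 𝓝 0, 0 < deriv S x :=
    (((hSC h0).continuousAt_fderiv two_ne_zero).clm_apply continuousAt_const).eventually
      (lt_mem_nhds hd0')
  have hall : ∀ᶠ s in 𝓝 0, S (ξ s) = s ∧ ContDiffAt ℝ 2 ξ s ∧ ξ s ∈ Ioo (-1) 1 ∧
      0 < P.eval (ξ s) ∧ 0 < deriv S (ξ s) ∧ ξ (-s) = -ξ s := by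
    filter_upwards [hright, hξC.eventually (by simp), hlim.eventually (Ioo_mem_nhds
      neg_one_lt_zero one_pos), hlim.eventually (hP.continuousAt.eventually (lt_mem_nhds h0)),
      hlim.eventually hdS, hlim'.eventually hleft] with s h1 h2 h3 h4 h5 h6
    rw [hodd, h1] at h6
    exact ⟨h1, h2, h3, h4, h5, h6⟩
  obtain ⟨ρ, hρ, hball⟩ := Metric.eventually_nhds_iff.1 hall
  replace hball : ∀ s ∈ Ioo (-ρ) ρ, S (ξ s) = s ∧ ContDiffAt ℝ 2 ξ s ∧ ξ s ∈ Ioo (-1) 1 ∧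
      0 < P.eval (ξ s) ∧ 0 < deriv S (ξ s) ∧ ξ (-s) = -ξ s := fun s hs =>
    hball (by rw [Real.dist_eq, sub_zero, abs_lt]; exact hs)
  have hξd : ∀ s ∈ Ioo (-ρ) ρ, HasDerivAt ξ (deriv ξ s) s := fun s hs =>
    ((hball s hs).2.1.differentiableAt two_ne_zero).hasDerivAt
  have hone : ∀ s ∈ Ioo (-ρ) ρ, deriv S (ξ s) * deriv ξ s = 1 := fun s hs => by
    refine ((hSd (hball s hs).2.2.2.1).comp s (hξd s hs)).unique
      ((hasDerivAt_id s).congr_of_eventuallyEq ?_)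
    filter_upwards [isOpen_Ioo.mem_nhds hs] with x hx using (hball x hx).1
  refine ⟨ρ, ξ, deriv ξ, ⟨hρ, hξd, fun s hs => ?_, fun s hs => ?_, fun s hs => ?_⟩,
    fun s hs => ⟨(hball s hs).2.2.1, (hball s hs).2.2.2.2.2, ?_⟩,
    fun s hs => ⟨(hball s hs).2.2.2.1, ?_⟩⟩
  · exact (((hball s hs).2.1.fderiv_right (m := 1) (by norm_num)).clm_apply
      contDiffAt_const).contDiffWithinAt
  · have := hone s hs
    exact pos_of_mul_pos_right (this ▸ one_pos) (hball s hs).2.2.2.2.1.le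
  · rw [← hSS (hball s hs).2.2.2.1, mul_assoc, hone s hs, mul_one, (hball s hs).1]
  · have hneg : -s ∈ Ioo (-ρ) ρ := ⟨by linarith [hs.2], by linarith [hs.1]⟩
    have h1 := (hξd _ hneg).comp s (hasDerivAt_neg s)
    have h2 : (ξ ∘ fun s => -s) =ᶠ[𝓝 s] fun s => -ξ s := by
      filter_upwards [isOpen_Ioo.mem_nhds hs] with x hx using (hball x hx).2.2.2.2.2
    have := ((hξd s hs).neg.congr_of_eventuallyEq h2).unique h1
    linarith
  · rw [← hsq (hball s hs).2.2.2.1, (hball s hs).1]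

namespace EnergyChart

variable {g : ℝ[X]} {ρ : ℝ} {ξ ξ' : ℝ → ℝ}

lemma disjoint_energyAnnulus (h : EnergyChart g ρ ξ ξ') {V W : Set ℝ} (hV : V ⊆ Ioo 0 ρ)
    (hW : W ⊆ Ioo 0 ρ) (hVW : Disjoint V W) :
    Disjoint (energyAnnulus ξ V) (energyAnnulus ξ W) := by
  rw [Set.disjoint_left]
  rintro _ ⟨r, hr, θ, rfl⟩ ⟨r', hr', θ', he⟩
  have hmem : ∀ r ∈ Ioo 0 ρ, r ∈ Ioo (-ρ) ρ := fun r hr => ⟨by linarith [hr.1, hr.2], hr.2⟩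
  obtain ⟨h1, h2⟩ := Prod.mk.inj he
  have h3 := h.strictMonoOn.injOn (mul_sin_mem_Ioo (hmem r (hV hr)) θ)
    (mul_sin_mem_Ioo (hmem r' (hW hr')) θ') h1
  have h4 : r ^ 2 = r' ^ 2 := by
    rw [← mul_one (r ^ 2), ← mul_one (r' ^ 2), ← Real.sin_sq_add_cos_sq θ]
    nth_rw 2 [Real.sin_sq_add_cos_sq θ]
    rw [← Real.sin_sq_add_cos_sq θ']
    linear_combination (r * Real.sin θ + r' * Real.sin θ') * h3 +
      (r * Real.cos θ + r' * Real.cos θ') * h2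
  have h5 : r = r' := (pow_left_inj₀ (hV hr).1.le (hW hr').1.le two_ne_zero).1 h4
  exact Set.disjoint_left.1 hVW hr (h5 ▸ hr')

end EnergyChart

lemma integral_sin_pow_mul_cos_sq_pos (l : ℕ) :
    0 < ∫ θ in (0 : ℝ)..2 * Real.pi, Real.sin θ ^ (2 * l) * Real.cos θ ^ 2 := by
  have hpi := Real.pi_pos
  refine intervalIntegral.integral_pos (by linarith) (by fun_prop) (fun θ _ => ?_)
    ⟨Real.pi / 4, ⟨by linarith, by linarith⟩, ?_⟩
  · rw [pow_mul]; positivity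
  · rw [Real.sin_pi_div_four, Real.cos_pi_div_four]; positivity

/-- In a well of an even potential, `p` simple cycles can be created by an even damping of
degree `2 * p`, whatever the odd part of the damping. -/
theorem exists_simple_cycles_of_even {P : ℝ[X]} (heven : ∀ x, P.eval (-x) = P.eval x)
    (h0 : 0 < P.eval 0) (p : ℕ) : ∃ e : ℝ[X], e.natDegree ≤ 2 * p ∧
      ∃ D : Fin p → Set (ℝ × ℝ), Pairwise (Disjoint on D) ∧ (∀ i, ∀ q ∈ D i, q.1 ∈ Ioo (-1) 1) ∧
        ∀ f : ℝ[X], (∀ x, f.eval (-x) = -f.eval x) → ∀ t ≠ 0, ∀ i,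
          HasSimpleCycleIn (f + C t * e) (derivative (X ^ 2 * P)) (Ioo (-1) 1) (D i) := by
  obtain ⟨ρ, ξ, ξ', hc, hodd, hP⟩ := exists_odd_energyChart heven h0
  have h0mem : (0 : ℝ) ∈ Ioo (-ρ) ρ := ⟨by linarith [hc.pos], hc.pos⟩
  set v : ℕ → ℝ → ℝ := fun l s => ξ' s / (2 * P.eval (ξ s)) ^ l with hv
  have hvC : ∀ l, ContDiffOn ℝ 1 (v l) (Ioo (-ρ) ρ) := fun l =>
    hc.contDiffOn.div ((contDiffOn_const.mul
      ((P.contDiff_aeval 1).comp_contDiffOn hc.contDiffOn_one)).pow l) fun s hs =>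
        pow_ne_zero _ (mul_ne_zero two_ne_zero (hP s hs).1.ne')
  have hv0 : ∀ l, 0 < v l 0 := fun l => div_pos (hc.deriv_pos 0 h0mem)
    (pow_pos (mul_pos two_pos (hP 0 h0mem).1) l)
  have hve : ∀ l, ∀ s ∈ Ioo (-ρ) ρ, ξ s ^ (2 * l) * ξ' s = s ^ (2 * l) * v l s := fun l s hs => by
    have h1 : (2 * P.eval (ξ s)) ≠ 0 := mul_ne_zero two_ne_zero (hP s hs).1.ne'
    rw [pow_mul, pow_mul, ← (hP s hs).2, mul_pow, hv]
    field_simp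
  set B : ℕ → ℝ → ℝ := fun l r => ∫ θ in (0 : ℝ)..2 * Real.pi,
    (Real.sin θ ^ (2 * l) * Real.cos θ ^ 2) * v l (r * Real.sin θ) with hB
  have hBC : ∀ l, ContDiffOn ℝ 1 (B l) (Ioo (-ρ) ρ) := fun l =>
    contDiffOn_integral_comp_mul_sin (by fun_prop) (hvC l)
  have hB0 : ∀ l, B l 0 ≠ 0 := fun l => by
    simp only [hB, zero_mul, intervalIntegral.integral_mul_const]
    exact (mul_pos (integral_sin_pow_mul_cos_sq_pos l) (hv0 l)).ne'
  obtain ⟨δ, -, Z, hZ, H⟩ := exists_sum_pow_mul_simple_zeros hc.pos p B hBC hB0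
  obtain ⟨U, hU, hdisj⟩ := (Set.toFinite (Z : Set ℝ)).t2_separation
  set e : ℝ[X] := ∑ l ∈ Finset.range (p + 1), C (δ l) * X ^ (2 * l) with he
  have hmel : ∀ f : ℝ[X], (∀ x, f.eval (-x) = -f.eval x) → ∀ t, ∀ r ∈ Ioo (-ρ) ρ,
      melnikov (damping (f + C t * e) ξ ξ') r =
        t * ∑ l ∈ Finset.range (p + 1), δ l * (r ^ (2 * l) * B l r) := by
    intro f hf t r hr
    have h1 : melnikov (damping f ξ ξ') r = 0 := melnikov_eq_zero_of_odd (fun s hs => by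
      simp only [damping]
      rw [(hodd s hs).2.1, (hodd s hs).2.2, hf, neg_mul]) hr
    have h2 : melnikov (damping (f + C t * e) ξ ξ') r = melnikov (damping f ξ ξ') r +
        t * melnikov (damping e ξ ξ') r := by
      rw [← melnikov_const_mul, ← melnikov_add (k' := fun s => t * damping e ξ ξ' s)
        (hc.contDiffOn_damping f).continuousOn
        (continuousOn_const.mul (hc.contDiffOn_damping e).continuousOn) hr]
      congr 1
      funext s
      simp only [damping, eval_add, eval_mul, eval_C]
      ring
    rw [h2, h1, zero_add]
    congr 1
    have hqint : ∀ l, Continuous fun θ => (Real.sin θ ^ (2 * l) * Real.cos θ ^ 2) *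
        v l (r * Real.sin θ) := fun l => (by fun_prop : Continuous fun θ : ℝ =>
          Real.sin θ ^ (2 * l) * Real.cos θ ^ 2).mul
        ((hvC l).continuousOn.comp_continuous (by fun_prop) (mul_sin_mem_Ioo hr))
    have h4 : ∑ l ∈ Finset.range (p + 1), δ l * (r ^ (2 * l) * B l r) =
        ∫ θ in (0 : ℝ)..2 * Real.pi, ∑ l ∈ Finset.range (p + 1), δ l * (r ^ (2 * l) *
          ((Real.sin θ ^ (2 * l) * Real.cos θ ^ 2) * v l (r * Real.sin θ))) := by
      have hqint' : ∀ l, Continuous fun θ => δ l * (r ^ (2 * l) *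
          ((Real.sin θ ^ (2 * l) * Real.cos θ ^ 2) * v l (r * Real.sin θ))) := fun l =>
        continuous_const.mul (continuous_const.mul (hqint l))
      rw [intervalIntegral.integral_finsetSum fun l _ => (hqint' l).intervalIntegrable _ _]
      simp only [hB, intervalIntegral.integral_const_mul]
    rw [h4]
    unfold melnikov
    congr 1
    funext θ
    have h3 : damping e ξ ξ' (r * Real.sin θ) =
        ∑ l ∈ Finset.range (p + 1), δ l * ((r * Real.sin θ) ^ (2 * l) * v l (r * Real.sin θ)) := by
      simp only [damping, he, eval_finsetSum, Finset.sum_mul, eval_mul, eval_C, eval_pow, eval_X]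
      refine Finset.sum_congr rfl fun l _ => ?_
      rw [← hve l _ (mul_sin_mem_Ioo hr θ), mul_assoc]
    rw [h3, Finset.mul_sum]
    refine Finset.sum_congr rfl fun l _ => ?_
    ring
  set z : Fin p → ℝ := fun i => Z.orderEmbOfFin hZ i
  have hzZ : ∀ i, z i ∈ Z := Z.orderEmbOfFin_mem hZ
  have hV : ∀ i, U (z i) ∩ Ioo 0 ρ ⊆ Ioo 0 ρ := fun i => inter_subset_right
  refine ⟨e, natDegree_sum_le_of_forall_le _ _ fun l hl => ?_,
    fun i => energyAnnulus ξ (U (z i) ∩ Ioo 0 ρ), fun i j hij => ?_, ?_, fun f hf t ht i => ?_⟩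
  · refine (natDegree_C_mul_X_pow_le _ _).trans ?_
    have := Finset.mem_range.1 hl
    omega
  · exact hc.disjoint_energyAnnulus (hV i) (hV j)
      ((hdisj (hzZ i) (hzZ j) ((Z.orderEmbOfFin hZ).injective.ne hij)).mono inter_subset_left
        inter_subset_left)
  · rintro i _ ⟨r, hr, θ, rfl⟩
    exact (hodd _ (mul_sin_mem_Ioo ⟨by linarith [hr.2.1, hr.2.2], hr.2.2⟩ θ)).1
  · obtain ⟨hzρ, hz0, hz1⟩ := H _ (hzZ i)
    have hzρ' : z i ∈ Ioo (-ρ) ρ := ⟨by linarith [hzρ.1, hzρ.2], hzρ.2⟩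
    refine ⟨ρ, ξ, ξ', U (z i) ∩ Ioo 0 ρ, z i, hc, fun s hs => (hodd s hs).1,
      (hU _).2.inter isOpen_Ioo, hV i, ⟨(hU _).1, hzρ⟩, ?_, ?_, Subset.rfl⟩
    · rw [hmel f hf t _ hzρ', hz0, mul_zero]
    · rw [Filter.EventuallyEq.deriv_eq (Filter.eventuallyEq_of_mem (isOpen_Ioo.mem_nhds hzρ')
        (hmel f hf t)), deriv_const_mul_field]
      exact mul_ne_zero ht hz1

/-- There are a damping of degree at most `m` and a potential of degree at most `m + 1`, tending to
`-∞` monotonically at infinity, with `n` simple cycles in disjoint regions. -/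
def HasSimpleCycles (m n : ℕ) : Prop :=
  ∃ (f G : ℝ[X]) (M : ℝ), f.natDegree ≤ m ∧ G.natDegree ≤ m + 1 ∧
    (∀ᶠ x in atTop, (derivative G).eval x < 0) ∧ (∀ᶠ x in atTop, 0 < (derivative G).eval (-x)) ∧
    ∃ (ι : Type) (_ : Fintype ι), Fintype.card ι = n ∧
      ∃ D : ι → Set (ℝ × ℝ), Pairwise (Disjoint on D) ∧
        ∀ i, HasSimpleCycleIn f (derivative G) (Ioo (-M) M) (D i)

lemma derivative_comp_sq_sub (G : ℝ[X]) (c : ℝ) : derivative (G.comp (X ^ 2 - C c)) =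
    (derivative G).comp (X ^ 2 - C c) * (2 * X) := by
  rw [derivative_comp, mul_comm, derivative_sub, derivative_X_sq, derivative_C, sub_zero, C_ofNat]

lemma exists_derivative_comp_sq_sub_eq (G : ℝ[X]) (c : ℝ) : ∃ Q : ℝ[X],
    Q.eval 0 = (derivative G).eval (-c) ∧
    derivative (G.comp (X ^ 2 - C c)) = derivative (X ^ 2 * Q.comp (X ^ 2)) := by
  have h := divX_mul_X_add (G.comp (X - C c))
  refine ⟨divX (G.comp (X - C c)), ?_, ?_⟩
  · have := congrArg (fun p => (derivative p).eval 0) h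
    simpa [derivative_comp] using this
  · have h2 : G.comp (X ^ 2 - C c) = (G.comp (X - C c)).comp (X ^ 2) := by
      rw [Polynomial.comp_assoc]; simp
    have h3 := congrArg (fun p => derivative (p.comp (X ^ 2))) h
    rw [h2, ← h3]
    simp only [add_comp, mul_comp, X_comp, C_comp, derivative_add, derivative_C, add_zero]
    rw [mul_comm]

lemma hasSimpleCycles_one : HasSimpleCycles 1 0 := by
  refine ⟨0, -X ^ 2, 1, by simp, by simp, ?_, ?_, Empty, inferInstance, by simp, isEmptyElim,
    fun i => i.elim, fun i => i.elim⟩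
  · filter_upwards [eventually_gt_atTop 0] with x hx
    simp; linarith
  · filter_upwards [eventually_gt_atTop 0] with x hx
    simp; linarith

lemma HasSimpleCycles.mono {m m' n : ℕ} (h : HasSimpleCycles m n) (hm : m ≤ m') :
    HasSimpleCycles m' n := by
  obtain ⟨f, G, M, hf, hG, h⟩ := h
  exact ⟨f, G, M, hf.trans hm, hG.trans (by omega), h⟩

lemma pairwise_disjoint_sumElim {α ι κ : Type*} {D : ι → Set α} {E : κ → Set α}
    (hD : Pairwise (Disjoint on D)) (hE : Pairwise (Disjoint on E))
    (hDE : ∀ i j, Disjoint (D i) (E j)) : Pairwise (Disjoint on Sum.elim D E) := by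
  rintro (i | i) (j | j) hij
  · exact hD fun h => hij (congrArg _ h)
  · exact hDE i j
  · exact (hDE j i).symm
  · exact hE fun h => hij (congrArg _ h)

/-- Folding the line doubles the simple cycles and adds `p` new ones in the new central well. -/
theorem HasSimpleCycles.double {m n m' p : ℕ} (h : HasSimpleCycles m n) (hm : 2 * m + 1 ≤ m')
    (hp : 2 * p ≤ m') : HasSimpleCycles m' (n + n + p) := by
  obtain ⟨f, G, M, hf, hG, htop, hbot, ι, _, hι, D, hD, hcyc⟩ := h
  obtain ⟨c, hc, hcM⟩ := (hbot.and (eventually_gt_atTop (|M| + 1))).exists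
  have hcM' : M + 1 < c := by linarith [le_abs_self M]
  have hc0 : 1 < c := by linarith [abs_nonneg M]
  obtain ⟨Q, hQ, hGQ⟩ := exists_derivative_comp_sq_sub_eq G c
  obtain ⟨e, he, E, hE, hE1, hEcyc⟩ := exists_simple_cycles_of_even (P := Q.comp (X ^ 2))
    (by simp) (by simpa [hQ] using hc) p
  rw [← hGQ] at hEcyc
  set f₁ := f.comp (X ^ 2 - C c) * (2 * X) with hf₁
  set G₁ := G.comp (X ^ 2 - C c) with hG₁
  have hG₁' := derivative_comp_sq_sub G c
  rw [← hG₁] at hG₁'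
  have hf₁odd : -f₁.comp (-X) = f₁ := by simp [hf₁, Polynomial.comp_assoc]
  have hg₁odd : -(derivative G₁).comp (-X) = derivative G₁ := by simp [hG₁', Polynomial.comp_assoc]
  have hg₁odd' : ∀ x, (derivative G₁).eval (-x) = -(derivative G₁).eval x := fun x => by
    nth_rw 2 [← hg₁odd]; simp
  have hR : ∀ i, HasSimpleCycleIn f₁ (derivative G₁) {x | 1 < x ∧ x ^ 2 - c ∈ Ioo (-M) M}
      {p | 1 < p.1 ∧ (p.1 ^ 2 - c, p.2) ∈ D i} := fun i => by
    rw [hG₁']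
    exact (hcyc i).unfold_sq fun x hx => by linarith [hx.1]
  have hL := fun i => (hR i).reflect
  rw [hf₁odd, hg₁odd] at hL
  have hpert : ∀ᶠ t in 𝓝[≠] (0 : ℝ), ∀ i,
      HasSimpleCycleIn (f₁ + C t * e) (derivative G₁) {x | 1 < x ∧ x ^ 2 - c ∈ Ioo (-M) M}
        {p | 1 < p.1 ∧ (p.1 ^ 2 - c, p.2) ∈ D i} ∧
      HasSimpleCycleIn (f₁ + C t * e) (derivative G₁) {x | 1 < -x ∧ (-x) ^ 2 - c ∈ Ioo (-M) M}
        {p | 1 < -p.1 ∧ ((-p.1) ^ 2 - c, p.2) ∈ D i} :=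
    nhdsWithin_le_nhds (eventually_all.2 fun i =>
      ((hR i).eventually_add_mul e).and ((hL i).eventually_add_mul e))
  obtain ⟨t, ht, ht0⟩ := (hpert.and self_mem_nhdsWithin).exists
  have hdeg2 : (X ^ 2 - C c : ℝ[X]).natDegree = 2 := natDegree_X_pow_sub_C
  have hbound : ∀ x : ℝ, x ^ 2 - c ∈ Ioo (-M) M → x ∈ Ioo (-(|M| + c)) (|M| + c) := fun x hx => by
    rw [mem_Ioo, ← abs_lt]
    refine abs_lt_of_sq_lt_sq ?_ (by linarith [abs_nonneg M])
    nlinarith [hx.2, le_abs_self M, abs_nonneg M]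
  have hneg : ∀ᶠ x in atTop, (derivative G₁).eval x < 0 := by
    have h1 : Tendsto (fun x : ℝ => x ^ 2 - c) atTop atTop :=
      tendsto_atTop_add_const_right _ _ (tendsto_pow_atTop two_ne_zero)
    filter_upwards [h1.eventually htop, eventually_gt_atTop 0] with x hx hx0
    rw [hG₁']
    simp only [eval_mul, eval_comp, eval_sub, eval_pow, eval_X, eval_C, eval_ofNat]
    exact mul_neg_of_neg_of_pos hx (by linarith)
  refine ⟨f₁ + C t * e, G₁, |M| + c, ?_, ?_, hneg, ?_, (ι ⊕ ι) ⊕ Fin p, inferInstance, by simp [hι],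
    Sum.elim (Sum.elim (fun i => {p | 1 < p.1 ∧ (p.1 ^ 2 - c, p.2) ∈ D i})
      fun i => {p | 1 < -p.1 ∧ ((-p.1) ^ 2 - c, p.2) ∈ D i}) E, ?_, ?_⟩
  · refine (natDegree_add_le_of_degree_le ?_ ((natDegree_C_mul_le _ _).trans (he.trans hp)))
    refine natDegree_mul_le.trans ?_
    have h1 : (2 * X : ℝ[X]).natDegree ≤ 1 := by
      rw [← C_ofNat]; exact natDegree_C_mul_le _ _ |>.trans natDegree_X_le
    rw [natDegree_comp, hdeg2]
    omega
  · rw [hG₁, natDegree_comp, hdeg2]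
    omega
  · filter_upwards [hneg] with x hx
    rw [hg₁odd']; linarith
  · refine pairwise_disjoint_sumElim (pairwise_disjoint_sumElim (fun i j hij => ?_)
      (fun i j hij => ?_) fun i j => ?_) hE ?_
    · exact Set.disjoint_left.2 fun q h1 h2 => Set.disjoint_left.1 (hD hij) h1.2 h2.2
    · exact Set.disjoint_left.2 fun q h1 h2 => Set.disjoint_left.1 (hD hij) h1.2 h2.2
    · exact Set.disjoint_left.2 fun q h1 h2 => by linarith [h1.1, h2.1]
    · rintro (i | i) j
      · exact Set.disjoint_left.2 fun q h1 h2 => by linarith [h1.1, (hE1 j q h2).2]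
      · exact Set.disjoint_left.2 fun q h1 h2 => by linarith [h1.1, (hE1 j q h2).1]
  · rintro ((i | i) | i)
    · exact (ht i).1.mono (fun x hx => hbound x hx.2) Subset.rfl
    · refine (ht i).2.mono (fun x hx => hbound x ?_) Subset.rfl
      rw [← neg_sq]; exact hx.2
    · refine (hEcyc f₁ (fun x => ?_) t ht0 i).mono (Ioo_subset_Ioo ?_ ?_) Subset.rfl
      · nth_rw 2 [← hf₁odd]; simp
      · linarith [abs_nonneg M]
      · linarith [abs_nonneg M]

/-- Simple cycles become limit cycles of the Liénard system. -/
theorem HasSimpleCycles.hGe {m n : ℕ} (h : HasSimpleCycles m n) : HGe m m n := by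
  obtain ⟨f, G, M, hf, hG, -, -, ι, _, hι, D, hD, hcyc⟩ := h
  refine ⟨f, derivative G, hf, (natDegree_derivative_le G).trans (by omega), ?_⟩
  have hlim : ∀ i, ∃ ε₀ > 0, ∀ ε, 0 < ε → ε ≤ ε₀ →
      ∃ Γ, IsLimitCycle (lienard f (derivative G) ε) Γ ∧ Γ ⊆ D i := fun i => by
    obtain ⟨ρ, ξ, ξ', V, r, hc, -, hV, hVρ, hr, h0, h1, hVD⟩ := hcyc i
    obtain ⟨ε₀, hε₀, H⟩ := hc.exists_isLimitCycle (hVρ hr) (hV.mem_nhds hr) h0 h1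
    refine ⟨ε₀, hε₀, fun ε he hle => ?_⟩
    obtain ⟨Γ, hΓ, hsub⟩ := H ε he hle
    exact ⟨Γ, hΓ, hsub.trans hVD⟩
  choose ε₀ hε₀ H using hlim
  obtain ⟨δ, hδ, hmin⟩ : ∃ δ > 0, ∀ i, δ ≤ ε₀ i := by
    have : ∀ᶠ δ in 𝓝[>] (0 : ℝ), ∀ i, δ ≤ ε₀ i := eventually_all.2 fun i =>
      nhdsWithin_le_nhds (Iic_mem_nhds (hε₀ i))
    obtain ⟨δ, h1, h2⟩ := (this.and self_mem_nhdsWithin).exists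
    exact ⟨δ, h2, h1⟩
  refine ⟨δ, hδ, fun ε he hle => ?_⟩
  choose Γ hΓ hsub using fun i => H i ε he (hle.trans (hmin i))
  have hinj : Injective Γ := fun i j hij => by
    by_contra hne
    obtain ⟨γ, -, -, -, hγ⟩ := (hΓ i).1
    have hmem : γ 0 ∈ Γ i := hγ ▸ mem_range_self 0
    exact Set.disjoint_left.1 (hD hne) (hsub i hmem) (hsub j (hij ▸ hmem))
  classical
  refine ⟨Finset.univ.image Γ, ?_, ?_⟩
  · simpa using hΓ
  · rw [Finset.card_image_of_injective _ hinj, Finset.card_univ, hι]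

lemma mul_log_div_six_le {x y : ℝ} (hx : 0 < x) (hxy : x ≤ y) (hy : 6 ≤ y) :
    x * Real.log (x / 6) ≤ y * Real.log (y / 6) :=
  (mul_le_mul_of_nonneg_left (Real.log_le_log (by positivity) (by gcongr)) hx.le).trans
    (mul_le_mul_of_nonneg_right hxy (Real.log_nonneg (by linarith)))

lemma mul_log_two_mul_div_six {x : ℝ} (hx : 0 < x) :
    2 * x * Real.log (2 * x / 6) = 2 * (x * Real.log (x / 6)) + 2 * x * Real.log 2 := by
  rw [mul_div_assoc, Real.log_mul two_ne_zero (by positivity)]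
  ring

lemma mul_log_le_of_pow_le {x a b : ℝ} {j k : ℕ} (ha : 0 < a) (hj : x = j)
    (h : a ^ j ≤ b ^ k) : x * Real.log a ≤ k * Real.log b := by
  rw [hj, ← Real.log_pow, ← Real.log_pow]
  exact Real.log_le_log (pow_pos ha j) h

theorem exists_hasSimpleCycles_ge {m : ℕ} (hm : 1 ≤ m) (hm2 : m ≠ 2) : ∃ n : ℕ,
    HasSimpleCycles m n ∧ ((m : ℝ) + 2) * Real.log (((m : ℝ) + 2) / 6) ≤
      3 * ((n : ℝ) - 1) * Real.log 2 := by
  have hlog : 0 < Real.log 2 := Real.log_pos one_lt_two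
  have h2 : HasSimpleCycles 2 0 := hasSimpleCycles_one.mono one_le_two
  induction m using Nat.strong_induction_on with
  | _ m ih =>
    have hbase : ∀ {j n : ℕ}, 3 < j → ((j : ℝ) / 6) ^ j ≤ 2 ^ (3 * n) →
        (j : ℝ) * Real.log (j / 6) ≤ 3 * ((n + 1 : ℝ) - 1) * Real.log 2 := fun {j n} hj h => by
      have := mul_log_le_of_pow_le (by positivity) rfl h
      push_cast at this
      linarith
    obtain rfl | rfl | rfl | hm' : m = 1 ∨ m = 5 ∨ m = 6 ∨
        (m ≠ 1 ∧ m ≠ 5 ∧ m ≠ 6) := by tauto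
    · refine ⟨0, hasSimpleCycles_one, ?_⟩
      rw [show (((1 : ℕ) : ℝ) + 2) / 6 = 2⁻¹ by norm_num, Real.log_inv]
      norm_num
    · refine ⟨2, h2.double (p := 2) (by norm_num) (by norm_num), ?_⟩
      have := hbase (j := 7) (n := 1) (by norm_num) (by norm_num)
      norm_num at this ⊢
      linarith
    · refine ⟨3, h2.double (p := 3) (by norm_num) (by norm_num), ?_⟩
      have := hbase (j := 8) (n := 2) (by norm_num) (by norm_num)
      norm_num at this ⊢
      linarith
    · obtain ⟨k, hk⟩ : ∃ k, m = 2 * k + 1 ∨ m = 2 * k + 2 := ⟨(m - 1) / 2, by omega⟩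
      obtain ⟨n, hn, hle⟩ := ih k (by omega) (by omega) (by omega)
      have hk0 : (1 : ℝ) ≤ k := by exact_mod_cast (by omega : 1 ≤ k)
      have hmul := mul_log_two_mul_div_six (x := (k : ℝ) + 2) (by positivity)
      have hmk : (m : ℝ) + 2 ≤ 2 * ((k : ℝ) + 2) := by
        have : (m : ℝ) ≤ 2 * k + 2 := by exact_mod_cast (by omega : m ≤ 2 * k + 2)
        linarith
      have hmono := mul_log_div_six_le (by positivity) hmk (by linarith)
      refine ⟨n + n + k, hn.double (by omega) (by omega), ?_⟩
      push_cast
      nlinarith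

end LimitCycles

theorem stmt10 (m : ℕ) (hm : 3 ≤ m) :
    HGe m m (((m : ℝ) + 2) * Real.log ((m : ℝ) + 2) / (3 * Real.log 2)
      - ((m : ℝ) + 2) / 3 * (1 + Real.log 3 / Real.log 2) + 1) := by
  obtain ⟨n, hn, hle⟩ := exists_hasSimpleCycles_ge (m := m) (by omega) (by omega)
  obtain ⟨f, g, hf, hg, ε₀, hε₀, H⟩ := hn.hGe
  refine ⟨f, g, hf, hg, ε₀, hε₀, fun ε he hle' => ?_⟩
  obtain ⟨S, hS, hcard⟩ := H ε he hle'
  refine ⟨S, hS, le_trans ?_ hcard⟩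
  have hlog : 0 < Real.log 2 := Real.log_pos one_lt_two
  have h6 : Real.log (((m : ℝ) + 2) / 6) = Real.log ((m : ℝ) + 2) - (Real.log 2 + Real.log 3) := by
    rw [Real.log_div (by positivity) (by norm_num), ← Real.log_mul (by norm_num) (by norm_num)]
    norm_num
  have heq : ((m : ℝ) + 2) * Real.log ((m : ℝ) + 2) / (3 * Real.log 2)
      - ((m : ℝ) + 2) / 3 * (1 + Real.log 3 / Real.log 2) + 1 =
      ((m : ℝ) + 2) * Real.log (((m : ℝ) + 2) / 6) / (3 * Real.log 2) + 1 := by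
    rw [h6]
    field_simp
  rw [heq, ← le_sub_iff_add_le, div_le_iff₀ (by positivity)]
  linarith
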